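/- arXiv:2404.14628 — 3 statements merged into one kernel-verified Lean document; each statement's English description precedes it below -/
import Mathlib

section
/- Let G = (μ,V,W,E,P,f,g) be a GCD graph with edge density δ > 0 such that R(G) ⊆ {p : p > C₆} and R♭(G) ≠ ∅. Then there is a GCD subgraph G' of G with edge density δ' > 0 and multiplicative data (P',f',g') such that: (a) G' is (P',f',g')-maximal; (b) P ⊊ P' ⊆ P ∪ R(G); (c) R(G') ⊊ R(G); (d) q(G') ≥ M^N·q(G), where N = #{p ∈ P'\P : f'(p) ≠ g'(p)}; (e) for every p ∈ P'\P, p^{f'(p)} exactly divides v for all vertices v of G' and p^{g'(p)} exactly divides w for all vertices w of G'. -/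
open Finset

/-- A (bipartite) GCD graph: a measure `μ` on `ℕ`, finite vertex sets `V, W` of positive
integers, an edge set `E ⊆ V × W`, a (finite) set of primes `P`, and exponent functions
`f, g` such that for every `p ∈ P`: `p^{f(p)} ∣ v` for all `v ∈ V`, `p^{g(p)} ∣ w` for all
`w ∈ W`, and `p^{min(f(p),g(p))}` exactly divides `gcd(v, w)` for every edge `(v, w)`. -/
structure GCDGraph where
  mu : ℕ → ℝ
  mu_nonneg : ∀ n, 0 ≤ mu n
  V : Finset ℕ
  W : Finset ℕ
  V_pos : ∀ v ∈ V, 0 < v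
  W_pos : ∀ w ∈ W, 0 < w
  E : Finset (ℕ × ℕ)
  E_sub : E ⊆ V ×ˢ W
  P : Finset ℕ
  P_prime : ∀ p ∈ P, p.Prime
  f : ℕ → ℕ
  g : ℕ → ℕ
  f_dvd : ∀ p ∈ P, ∀ v ∈ V, p ^ f p ∣ v
  g_dvd : ∀ p ∈ P, ∀ w ∈ W, p ^ g p ∣ w
  gcd_exact : ∀ p ∈ P, ∀ e ∈ E,
    p ^ min (f p) (g p) ∣ Nat.gcd e.1 e.2 ∧ ¬ p ^ (min (f p) (g p) + 1) ∣ Nat.gcd e.1 e.2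

namespace GCDGraph

/-- The measure of a finite set of integers: `μ(S) = ∑_{n ∈ S} μ(n)`. -/
noncomputable def muSet (mu : ℕ → ℝ) (S : Finset ℕ) : ℝ := ∑ n ∈ S, mu n

/-- The measure of a finite set of pairs: `μ(E) = ∑_{(n₁,n₂) ∈ E} μ(n₁) μ(n₂)`. -/
noncomputable def muEdges (mu : ℕ → ℝ) (E : Finset (ℕ × ℕ)) : ℝ := ∑ e ∈ E, mu e.1 * mu e.2

/-- Edge density `δ = μ(E) / (μ(V) μ(W))` (equal to `0` when `μ(V) μ(W) = 0`,
by the Lean convention `x / 0 = 0`). -/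
noncomputable def densityRaw (mu : ℕ → ℝ) (V W : Finset ℕ) (E : Finset (ℕ × ℕ)) : ℝ :=
  muEdges mu E / (muSet mu V * muSet mu W)

/-- The quality
`q = δ^{2+τ} μ(V) μ(W) ∏_{p ∈ P} p^{|f(p)-g(p)|} (1 - 1_{f(p)=g(p)≥1}/p)^{-2} (1 - p^{-1-τ/4})^{-3}`. -/
noncomputable def qualityRaw (τ : ℝ) (mu : ℕ → ℝ) (V W : Finset ℕ) (E : Finset (ℕ × ℕ))
    (P : Finset ℕ) (f g : ℕ → ℕ) : ℝ :=
  densityRaw mu V W E ^ (2 + τ) * muSet mu V * muSet mu W *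
    ∏ p ∈ P, ((p : ℝ) ^ (((f p : ℤ) - (g p : ℤ)).natAbs) *
      ((1 - (if f p = g p ∧ 1 ≤ f p then ((p : ℝ))⁻¹ else 0))⁻¹) ^ 2 *
      ((1 - (p : ℝ) ^ (-1 - τ / 4))⁻¹) ^ 3)

/-- The edge density of a GCD graph. -/
noncomputable def density (G : GCDGraph) : ℝ := densityRaw G.mu G.V G.W G.E

/-- The quality of a GCD graph (with parameter `τ`). -/
noncomputable def quality (τ : ℝ) (G : GCDGraph) : ℝ :=
  qualityRaw τ G.mu G.V G.W G.E G.P G.f G.g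

/-- `G'` is a GCD subgraph of `G`. -/
def IsSubgraph (G' G : GCDGraph) : Prop :=
  G'.mu = G.mu ∧ G'.V ⊆ G.V ∧ G'.W ⊆ G.W ∧ G'.E ⊆ G.E ∧ G.P ⊆ G'.P ∧
    (∀ p ∈ G.P, G'.f p = G.f p) ∧ (∀ p ∈ G.P, G'.g p = G.g p)

/-- `G` is `(P,f,g)`-maximal: every GCD subgraph with the same multiplicative data has
quality at most `q(G)`. -/
def IsMaximal (τ : ℝ) (G : GCDGraph) : Prop :=
  ∀ G' : GCDGraph, IsSubgraph G' G → G'.P = G.P → quality τ G' ≤ quality τ G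

/-- `R(G)`: the set of primes `p ∉ P` dividing `gcd(v,w)` for some edge `(v,w)`. -/
def R (G : GCDGraph) : Set ℕ :=
  {p | p.Prime ∧ p ∉ G.P ∧ ∃ e ∈ G.E, p ∣ Nat.gcd e.1 e.2}

/-- `S_{p^k}`: the subset of elements of `S` exactly divisible by `p^k`. -/
def exactPart (S : Finset ℕ) (p k : ℕ) : Finset ℕ :=
  S.filter fun v => p ^ k ∣ v ∧ ¬ p ^ (k + 1) ∣ v

/-- `E_{p^k, p^ℓ} = E ∩ (V_{p^k} × W_{p^ℓ})`. -/
def edgesAt (G : GCDGraph) (p k l : ℕ) : Finset (ℕ × ℕ) :=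
  G.E.filter fun e => e.1 ∈ exactPart G.V p k ∧ e.2 ∈ exactPart G.W p l

/-- The quality of the GCD subgraph `G_{p^k, p^ℓ}`, with vertex sets `V_{p^k}`, `W_{p^ℓ}`,
edges `E_{p^k,p^ℓ}`, prime set `P ∪ {p}` and `f, g` extended by `f(p) = k`, `g(p) = ℓ`. -/
noncomputable def qualityAt (τ : ℝ) (G : GCDGraph) (p k l : ℕ) : ℝ :=
  qualityRaw τ G.mu (exactPart G.V p k) (exactPart G.W p l) (edgesAt G p k l)
    (insert p G.P) (Function.update G.f p k) (Function.update G.g p l)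

noncomputable def C1 (τ : ℝ) : ℝ := 10 ^ 4 / τ
noncomputable def C2 (τ M : ℝ) : ℝ := 10 * M * C1 τ ^ 3
noncomputable def C3 (τ : ℝ) : ℝ := 10 ^ 3 * C1 τ ^ 3
noncomputable def C4 (τ M : ℝ) : ℝ := 10 ^ 10 * M ^ 2 * C2 τ M ^ 2
noncomputable def C5 (τ M : ℝ) : ℝ := max (C3 τ) ((50 * Real.log (C4 τ M)) ^ 3)
noncomputable def C6 (τ M : ℝ) : ℝ :=
  max (C4 τ M) (max (10 ^ 4 * M * C2 τ M) (C2 τ M ^ (10 / τ)))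
noncomputable def C7 (τ M : ℝ) : ℝ := C5 τ M ^ C6 τ M

/-- `R♯(G)`: those `p ∈ R(G)` admitting `k ≥ 0` with `μ(V_{p^k})/μ(V) ≥ 1 − C₂/p` and
`μ(W_{p^k})/μ(W) ≥ 1 − C₂/p`, and such that `q(G_{p^a,p^b}) < M q(G)` for all `a ≠ b`. -/
def Rsharp (τ M : ℝ) (G : GCDGraph) : Set ℕ :=
  {p ∈ R G |
    (∃ k : ℕ, 1 - C2 τ M / (p : ℝ) ≤ muSet G.mu (exactPart G.V p k) / muSet G.mu G.V ∧
        1 - C2 τ M / (p : ℝ) ≤ muSet G.mu (exactPart G.W p k) / muSet G.mu G.W) ∧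
    ∀ a b : ℕ, a ≠ b → qualityAt τ G p a b < M * quality τ G}

/-- `R♭(G) = R(G) \ R♯(G)`. -/
def Rflat (τ M : ℝ) (G : GCDGraph) : Set ℕ := R G \ Rsharp τ M G

/-- The neighbourhood `Γ_G(v) = {w ∈ W : (v,w) ∈ E}` of a left vertex. -/
def nbhdOfV (G : GCDGraph) (v : ℕ) : Finset ℕ := G.W.filter fun w => (v, w) ∈ G.E

/-- The neighbourhood `Γ_G(w) = {v ∈ V : (v,w) ∈ E}` of a right vertex. -/
def nbhdOfW (G : GCDGraph) (w : ℕ) : Finset ℕ := G.V.filter fun v => (v, w) ∈ G.E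

end GCDGraph

open GCDGraph


lemma aux_geom (ρ : ℝ) (h0 : 0 ≤ ρ) (h1 : ρ ≤ 1/3) (n : ℕ) :
    ∑ j ∈ range n, ρ ^ (j+1) ≤ 3/2 * ρ := by
  have : ∀ n : ℕ, ∑ j ∈ range n, ρ ^ (j+1) ≤ 3/2 * ρ * (1 - ρ ^ n) := by
    intro n
    induction n with
    | zero => simp
    | succ k ih =>
      rw [sum_range_succ]
      have hp : 0 ≤ ρ ^ (k+1) := by positivity
      have e : ρ ^ (k+1) = ρ * ρ ^ k := by ring
      nlinarith
  refine (this n).trans ?_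
  have hp : 0 ≤ ρ ^ n := by positivity
  nlinarith

lemma aux_row (ρ : ℝ) (h0 : 0 ≤ ρ) (k : ℕ) : ∀ n : ℕ,
    ∑ l ∈ range n, (if k = l then 0 else ρ ^ ((k:ℤ) - (l:ℤ)).natAbs) ≤
      ∑ j ∈ range k, ρ ^ (j+1) + ∑ j ∈ range n, ρ ^ (j+1) := by
  induction k with
  | zero =>
    intro n
    rw [range_zero, sum_empty, zero_add]
    cases n with
    | zero => simp
    | succ n =>
      rw [sum_range_succ', sum_range_succ]
      have : 0 ≤ ρ ^ (n+1) := by positivity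
      have : ∑ l ∈ range n, (if 0 = l+1 then 0 else ρ ^ (((0:ℕ):ℤ) - ((l+1:ℕ):ℤ)).natAbs) =
        ∑ l ∈ range n, ρ ^ (l+1) := by
        refine sum_congr rfl fun l _ => ?_
        rw [if_neg (by omega)]
        congr 1
      rw [this]; simp; positivity
  | succ k ih =>
    intro n
    cases n with
    | zero =>
      simp only [range_zero, sum_empty, add_zero]
      exact sum_nonneg fun _ _ => by positivity
    | succ n =>
      rw [sum_range_succ', sum_range_succ _ k, sum_range_succ _ n]
      have h1 : 0 ≤ ρ ^ (n+1) := by positivity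
      have h2 : ∑ l ∈ range n, (if k+1 = l+1 then 0 else ρ ^ (((k+1:ℕ):ℤ) - ((l+1:ℕ):ℤ)).natAbs) =
        ∑ l ∈ range n, (if k = l then 0 else ρ ^ ((k:ℤ) - (l:ℤ)).natAbs) := by
        refine sum_congr rfl fun l _ => ?_
        simp
      have h3 : (if k+1 = 0 then 0 else ρ ^ (((k+1:ℕ):ℤ) - ((0:ℕ):ℤ)).natAbs) = ρ^(k+1) := by
        rw [if_neg (by omega)]
        congr 1
      rw [h2, h3]
      linarith [ih n]

/-- the kernel -/
noncomputable def Kk (ρ : ℝ) (k l : ℕ) : ℝ := if k = l then 0 else ρ ^ ((k:ℤ) - (l:ℤ)).natAbs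

lemma Kk_nonneg (ρ : ℝ) (h0 : 0 ≤ ρ) (k l : ℕ) : 0 ≤ Kk ρ k l := by
  unfold Kk; split_ifs <;> positivity

lemma Kk_symm (ρ : ℝ) (k l : ℕ) : Kk ρ k l = Kk ρ l k := by
  unfold Kk
  by_cases h : k = l
  · simp [h]
  · rw [if_neg h, if_neg (Ne.symm h)]
    congr 1
    omega

lemma Kk_row (ρ : ℝ) (h0 : 0 ≤ ρ) (h1 : ρ ≤ 1/3) (k n : ℕ) :
    ∑ l ∈ range n, Kk ρ k l ≤ 3 * ρ := by
  have := aux_row ρ h0 k n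
  have := aux_geom ρ h0 h1 n
  have := aux_geom ρ h0 h1 k
  unfold Kk
  linarith

lemma Kk_dbl (ρ : ℝ) (h0 : 0 ≤ ρ) (h1 : ρ ≤ 1/3) (n : ℕ) (a b : ℕ → ℝ)
    (ha : ∀ k, 0 ≤ a k) (hb : ∀ k, 0 ≤ b k) :
    ∑ k ∈ range n, ∑ l ∈ range n, (a k + b l) / 2 * Kk ρ k l ≤
      3 * ρ * ((∑ k ∈ range n, a k + ∑ k ∈ range n, b k) / 2) := by
  have e : ∑ k ∈ range n, ∑ l ∈ range n, (a k + b l) / 2 * Kk ρ k l =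
      ∑ k ∈ range n, (a k / 2) * ∑ l ∈ range n, Kk ρ k l +
      ∑ k ∈ range n, (b k / 2) * ∑ l ∈ range n, Kk ρ k l := by
    have : ∑ k ∈ range n, (b k / 2) * ∑ l ∈ range n, Kk ρ k l =
       ∑ k ∈ range n, ∑ l ∈ range n, b l / 2 * Kk ρ k l := by
      rw [sum_comm]
      refine sum_congr rfl fun k _ => ?_
      rw [mul_sum]
      exact sum_congr rfl fun l _ => by rw [Kk_symm]
    rw [this, ← sum_add_distrib]
    refine sum_congr rfl fun k _ => ?_
    rw [mul_sum, ← sum_add_distrib]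
    exact sum_congr rfl fun l _ => by ring
  rw [e]
  have i1 : ∀ a : ℕ → ℝ, (∀ k, 0 ≤ a k) → ∑ k ∈ range n, (a k / 2) * ∑ l ∈ range n, Kk ρ k l ≤
      3 * ρ * ((∑ k ∈ range n, a k) / 2) := by
    intro a ha
    rw [sum_div, mul_sum]
    refine sum_le_sum fun k _ => ?_
    rw [mul_comm]
    exact mul_le_mul_of_nonneg_right (Kk_row ρ h0 h1 k n) (by have := ha k; positivity)
  have := i1 a ha
  have := i1 b hb
  linarith

lemma amgm_pow (s θ a b : ℝ) (hs : 2 * s = 1 + θ) (hθ : 0 < θ) (ha : 0 ≤ a) (hb : 0 ≤ b) :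
    (a * b) ^ s ≤ ((a + b) / 2) ^ θ * ((a + b) / 2) := by
  have h : a * b ≤ ((a+b)/2) ^ (2:ℕ) := by nlinarith [sq_nonneg (a-b)]
  calc (a * b) ^ s ≤ (((a+b)/2) ^ (2:ℕ)) ^ s :=
        Real.rpow_le_rpow (by positivity) h (by linarith)
    _ = ((a+b)/2) ^ (θ + 1) := by
        rw [← Real.rpow_natCast, ← Real.rpow_mul (by positivity)]
        congr 1; push_cast; linarith
    _ = _ := by rw [Real.rpow_add_one' (by positivity) (by linarith)]

lemma bern (θ c : ℝ) (hθ : 0 < θ) (hθ1 : θ ≤ 1) (hc : 0 ≤ c) : c ^ θ ≤ 1 - θ * (1 - c) := by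
  have := rpow_one_add_le_one_add_mul_self (s := c - 1) (by linarith) hθ.le hθ1
  have e : 1 + (c - 1) = c := by ring
  rw [e] at this
  linarith

set_option maxHeartbeats 1000000 in
lemma key (s θ ρ N C : ℝ) (hs : 2 * s = 1 + θ) (hθ : 0 < θ) (hθ1 : θ ≤ 1)
    (hρ0 : 0 ≤ ρ) (hρ : ρ ≤ 1/3) (hN : 0 ≤ N) (hε : 3 * (N * ρ) < θ / 10)
    (hC : 0 ≤ C)
    (hm : ∀ m : ℝ, 0 < m → C < 2 * m → 9 * (N * ρ) * (2 * m) ^ s < 1.8 * θ * m)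
    (n : ℕ) (α β : ℕ → ℝ) (hα : ∀ k, 0 ≤ α k) (hβ : ∀ k, 0 ≤ β k)
    (sα : ∑ k ∈ range n, α k = 1) (sβ : ∑ k ∈ range n, β k = 1)
    (hnc : ∀ k, ¬ (1 - C ≤ α k ∧ 1 - C ≤ β k)) :
    ∑ k ∈ range n, ∑ l ∈ range n,
      (if k = l then (α k * β l) ^ s else N * (α k * β l) ^ s * ρ ^ ((k:ℤ) - (l:ℤ)).natAbs) < 1 := by
  have hs0 : 0 < s := by linarith
  have hs1 : s ≤ 1 := by linarith
  have split : ∑ k ∈ range n, ∑ l ∈ range n,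
      (if k = l then (α k * β l) ^ s else N * (α k * β l) ^ s * ρ ^ ((k:ℤ) - (l:ℤ)).natAbs) =
      ∑ k ∈ range n, (α k * β k) ^ s +
      N * ∑ k ∈ range n, ∑ l ∈ range n, (α k * β l) ^ s * Kk ρ k l := by
    rw [mul_sum, ← sum_add_distrib]
    refine sum_congr rfl fun k hk => ?_
    have : (α k * β k) ^ s = ∑ l ∈ range n, if k = l then (α k * β l) ^ s else 0 := by
      rw [sum_ite_eq, if_pos hk]
    rw [this, mul_sum, ← sum_add_distrib]
    refine sum_congr rfl fun l _ => ?_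
    unfold Kk
    split_ifs
    · simp
    · ring
  rw [split]
  have ale : ∀ k ∈ range n, α k ≤ 1 := fun k hk => by
    rw [← sα]; exact single_le_sum (fun i _ => hα i) hk
  have ble : ∀ k ∈ range n, β k ≤ 1 := fun k hk => by
    rw [← sβ]; exact single_le_sum (fun i _ => hβ i) hk
  -- the termwise bound
  have tb : ∀ a b : ℝ, 0 ≤ a → 0 ≤ b → a ≤ 1 → b ≤ 1 → (a * b) ^ s ≤ (a + b) / 2 := by
    intro a b ha hb ha1 hb1
    refine (amgm_pow s θ a b hs hθ ha hb).trans ?_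
    have : ((a+b)/2) ^ θ ≤ 1 := Real.rpow_le_one (by positivity) (by linarith) hθ.le
    nlinarith
  have sc : ∑ k ∈ range n, (α k + β k) / 2 = 1 := by
    rw [← sum_div, sum_add_distrib, sα, sβ]; norm_num
  by_cases hcase : ∀ k ∈ range n, (α k + β k) / 2 ≤ 9/10
  · have d : ∑ k ∈ range n, (α k * β k) ^ s ≤ 1 - θ/10 := by
      calc ∑ k ∈ range n, (α k * β k) ^ s ≤ ∑ k ∈ range n, (1 - θ/10) * ((α k + β k)/2) := by
            refine sum_le_sum fun k hk => (amgm_pow s θ _ _ hs hθ (hα k) (hβ k)).trans ?_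
            have h0 : 0 ≤ (α k + β k)/2 := by have := hα k; have := hβ k; positivity
            refine mul_le_mul_of_nonneg_right ((bern θ _ hθ hθ1 h0).trans ?_) h0
            nlinarith [hcase k hk]
        _ = 1 - θ/10 := by rw [← mul_sum, sc, mul_one]
    have o : ∑ k ∈ range n, ∑ l ∈ range n, (α k * β l) ^ s * Kk ρ k l ≤ 3 * ρ := by
      calc _ ≤ ∑ k ∈ range n, ∑ l ∈ range n, (α k + β l) / 2 * Kk ρ k l := by
            refine sum_le_sum fun k hk => sum_le_sum fun l hl => ?_
            exact mul_le_mul_of_nonneg_right (tb _ _ (hα k) (hβ l) (ale k hk) (ble l hl))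
              (Kk_nonneg ρ hρ0 k l)
        _ ≤ _ := Kk_dbl ρ hρ0 hρ n α β hα hβ
        _ = 3 * ρ := by rw [sα, sβ]; ring
    have := mul_le_mul_of_nonneg_left o hN
    linarith
  · push Not at hcase
    obtain ⟨k0, hk0, hc⟩ := hcase
    set m : ℝ := 1 - (α k0 + β k0)/2 with hmdef
    have hm1 : m < 1/10 := by linarith
    have h2m : C < 2 * m := by
      have h1 := ale k0 hk0
      have h2 := ble k0 hk0
      have := hnc k0
      by_contra hcon
      apply this
      constructor <;> linarith
    have hm0 : 0 < m := by linarith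
    have hmm := hm m hm0 h2m
    have sumc : ∑ k ∈ (range n).erase k0, (α k + β k)/2 = m := by
      have := add_sum_erase (range n) (fun k => (α k + β k)/2) hk0
      simp only [sc] at this
      linarith
    have suma : ∑ k ∈ (range n).erase k0, α k = 1 - α k0 := by
      have := add_sum_erase (range n) α hk0
      linarith
    have sumb : ∑ k ∈ (range n).erase k0, β k = 1 - β k0 := by
      have := add_sum_erase (range n) β hk0
      linarith
    have d : ∑ k ∈ range n, (α k * β k) ^ s ≤ 1 - 2 * θ * m * (1 - m) := by
      rw [← add_sum_erase _ _ hk0]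
      have d1 : (α k0 * β k0) ^ s ≤ (1 - θ * m) * (1 - m) := by
        refine (amgm_pow s θ _ _ hs hθ (hα k0) (hβ k0)).trans ?_
        have h0 : 0 ≤ (α k0 + β k0)/2 := by linarith
        have e : (α k0 + β k0)/2 = 1 - m := by rw [hmdef]; ring
        refine (mul_le_mul_of_nonneg_right (bern θ _ hθ hθ1 h0) h0).trans ?_
        rw [e]; apply le_of_eq; ring
      have d2 : ∑ k ∈ (range n).erase k0, (α k * β k) ^ s ≤ (1 - θ * (1 - m)) * m := by
        calc _ ≤ ∑ k ∈ (range n).erase k0, (1 - θ * (1 - m)) * ((α k + β k)/2) := by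
              refine sum_le_sum fun k hk => (amgm_pow s θ _ _ hs hθ (hα k) (hβ k)).trans ?_
              have h0 : 0 ≤ (α k + β k)/2 := by have := hα k; have := hβ k; positivity
              refine mul_le_mul_of_nonneg_right ((bern θ _ hθ hθ1 h0).trans ?_) h0
              have : (α k + β k)/2 ≤ m := by
                rw [← sumc]
                exact single_le_sum (f := fun k => (α k + β k)/2)
                  (fun i _ => by have := hα i; have := hβ i; positivity) hk
              nlinarith
          _ = _ := by rw [← mul_sum, sumc]
      calc _ ≤ (1 - θ * m) * (1 - m) + (1 - θ * (1 - m)) * m := add_le_add d1 d2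
        _ = _ := by ring
    -- modified sequences
    set a : ℕ → ℝ := fun k => if k ∈ (range n).erase k0 then α k else 0 with ha
    set b : ℕ → ℝ := fun k => if k ∈ (range n).erase k0 then β k else 0 with hb
    have a0 : ∀ k, 0 ≤ a k := fun k => by simp only [ha]; split_ifs <;> simp [hα]
    have b0 : ∀ k, 0 ≤ b k := fun k => by simp only [hb]; split_ifs <;> simp [hβ]
    have saa : ∑ k ∈ range n, a k = 1 - α k0 := by
      rw [← suma, ha, ← sum_filter]
      congr 1; ext i; simp
    have sbb : ∑ k ∈ range n, b k = 1 - β k0 := by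
      rw [← sumb, hb, ← sum_filter]
      congr 1; ext i; simp
    set Y : ℝ := (2 * m) ^ s with hY
    have hY0 : 0 ≤ Y := by positivity
    have hmY : m ≤ Y := by
      have : 2 * m ≤ Y := by
        conv_lhs => rw [← Real.rpow_one (2*m)]
        exact Real.rpow_le_rpow_of_exponent_ge (by linarith) (by linarith) hs1
      linarith
    have ak : ∀ k ∈ (range n).erase k0, α k ≤ 2 * m := fun k hk => by
      have := single_le_sum (f := α) (fun i _ => hα i) hk
      have := ble k0 hk0
      linarith
    have bk : ∀ k ∈ (range n).erase k0, β k ≤ 2 * m := fun k hk => by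
      have := single_le_sum (f := β) (fun i _ => hβ i) hk
      have := ale k0 hk0
      linarith
    have o : ∑ k ∈ range n, ∑ l ∈ range n, (α k * β l) ^ s * Kk ρ k l ≤ 9 * ρ * Y := by
      have pt : ∀ k ∈ range n, ∀ l ∈ range n, (α k * β l) ^ s * Kk ρ k l ≤
          (a k + b l)/2 * Kk ρ k l + (if k = k0 then Y * Kk ρ k0 l else 0) +
          (if l = k0 then Y * Kk ρ k0 k else 0) := by
        intro k hk l hl
        have hK := Kk_nonneg ρ hρ0 k l
        have hK1 := Kk_nonneg ρ hρ0 k0 l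
        have hK2 := Kk_nonneg ρ hρ0 k0 k
        have hab : 0 ≤ (a k + b l)/2 * Kk ρ k l := by
          have := a0 k; have := b0 l; positivity
        have hYK1 := mul_nonneg hY0 hK1
        have hYK2 := mul_nonneg hY0 hK2
        by_cases h1 : k = k0
        · by_cases h2 : l = k0
          · have : Kk ρ k l = 0 := by simp [Kk, h1, h2]
            rw [this]
            simp only [mul_zero]
            split_ifs <;> positivity
          · rw [if_pos h1, if_neg h2]
            have : (α k * β l) ^ s ≤ Y := by
              refine Real.rpow_le_rpow (mul_nonneg (hα k) (hβ l)) ?_ hs0.le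
              have := bk l (mem_erase.2 ⟨h2, hl⟩)
              nlinarith [ale k hk, hα k, hβ l]
            subst h1
            have := mul_le_mul_of_nonneg_right this hK
            linarith
        · by_cases h2 : l = k0
          · rw [if_neg h1, if_pos h2]
            have : (α k * β l) ^ s ≤ Y := by
              refine Real.rpow_le_rpow (mul_nonneg (hα k) (hβ l)) ?_ hs0.le
              have := ak k (mem_erase.2 ⟨h1, hk⟩)
              nlinarith [ble l hl, hα k, hβ l]
            subst h2
            have := mul_le_mul_of_nonneg_right this hK
            rw [Kk_symm ρ k l] at *
            linarith
          · rw [if_neg h1, if_neg h2]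
            have e1 : a k = α k := by simp only [ha]; rw [if_pos (mem_erase.2 ⟨h1, hk⟩)]
            have e2 : b l = β l := by simp only [hb]; rw [if_pos (mem_erase.2 ⟨h2, hl⟩)]
            rw [e1, e2]
            have := mul_le_mul_of_nonneg_right (tb _ _ (hα k) (hβ l) (ale k hk) (ble l hl)) hK
            linarith
      have step := sum_le_sum fun k hk => sum_le_sum fun l hl => pt k hk l hl
      refine step.trans ?_
      simp only [sum_add_distrib]
      have t1 := Kk_dbl ρ hρ0 hρ n a b a0 b0
      have t2 : ∑ k ∈ range n, ∑ l ∈ range n, (if k = k0 then Y * Kk ρ k0 l else 0) =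
          Y * ∑ l ∈ range n, Kk ρ k0 l := by
        rw [sum_comm, mul_sum]
        refine sum_congr rfl fun l _ => ?_
        rw [sum_ite_eq', if_pos hk0]
      have t3 : ∑ k ∈ range n, ∑ l ∈ range n, (if l = k0 then Y * Kk ρ k0 k else 0) =
          Y * ∑ l ∈ range n, Kk ρ k0 l := by
        rw [mul_sum]
        refine sum_congr rfl fun l _ => ?_
        rw [sum_ite_eq', if_pos hk0]
      rw [t2, t3]
      have t4 := mul_le_mul_of_nonneg_left (Kk_row ρ hρ0 hρ k0 n) hY0
      rw [saa, sbb] at t1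
      have t5 : (1 - α k0 + (1 - β k0))/2 = m := by rw [hmdef]; ring
      rw [t5] at t1
      have t6 := mul_le_mul_of_nonneg_left hmY hρ0
      linarith
    have := mul_le_mul_of_nonneg_left o hN
    have hθm : θ * m * (1/10) ≥ θ * m * m := mul_le_mul_of_nonneg_left hm1.le (by positivity)
    have h1 : N * (9 * ρ * Y) = 9 * (N * ρ) * Y := by ring
    have h2 : 2 * θ * m * (1 - m) ≥ 1.8 * θ * m := by
      have : 2 * θ * m * (1 - m) = 2 * (θ * m) - 2 * (θ * m * m) := by ring
      rw [this]; linarith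
    linarith

lemma consts (τ M p : ℝ) (h0 : 0 < τ) (h1 : τ < 1/100) (hM : 2 ≤ M) (hp : C6 τ M < p) :
    0 < p ∧ 1 < p ∧ 0 ≤ C2 τ M / p ∧ p ^ (-(1/(2+τ))) ≤ 1/3 ∧
    3 * (M ^ (1/(2+τ)) * p ^ (-(1/(2+τ)))) < τ/(2+τ) / 10 ∧
    ∀ m : ℝ, 0 < m → C2 τ M / p < 2 * m →
      9 * (M ^ (1/(2+τ)) * p ^ (-(1/(2+τ)))) * (2 * m) ^ ((1+τ)/(2+τ)) < 1.8 * (τ/(2+τ)) * m := by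
  set r : ℝ := 1/(2+τ) with hr
  have hr0 : 0 < r := by positivity
  have hr3 : 1/3 ≤ r := by
    rw [hr]; apply one_div_le_one_div_of_le <;> linarith
  have hC1 : 10^6 ≤ C1 τ := by
    unfold C1; rw [le_div_iff₀ h0]; linarith
  have hC1i : (C1 τ)⁻¹ = τ / 10^4 := by unfold C1; rw [inv_div]
  set D : ℝ := 10 * C1 τ ^ 3 with hD
  have hC2 : C2 τ M = M * D := by unfold C2; ring
  have hDC : C1 τ ^ 3 ≤ D := by rw [hD]; nlinarith [pow_pos (show 0 < C1 τ by linarith) 3]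
  have hD1 : 1 ≤ D := le_trans (one_le_pow₀ (by linarith)) hDC
  have hDr : C1 τ ≤ D ^ r := by
    calc C1 τ = (C1 τ ^ 3) ^ (1/3:ℝ) := by
          rw [← Real.rpow_natCast, ← Real.rpow_mul (by linarith)]; norm_num
      _ ≤ D ^ (1/3:ℝ) := Real.rpow_le_rpow (by positivity) hDC (by norm_num)
      _ ≤ D ^ r := Real.rpow_le_rpow_of_exponent_le hD1 hr3
  have hDri : (D ^ r)⁻¹ ≤ τ / 10^4 := by
    rw [← hC1i]; exact inv_anti₀ (by linarith) hDr
  have hMD : 1 ≤ M * D := by nlinarith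
  have hpC : C2 τ M < p := by
    refine lt_of_le_of_lt ?_ (lt_of_le_of_lt (le_max_left _ _) hp)
    unfold C4
    rw [hC2]
    have : M * D ≤ (M * D)^2 := by nlinarith
    have : 1 ≤ M^2 := by nlinarith
    nlinarith
  rw [hC2] at hpC ⊢
  have hp0 : 0 < p := by linarith
  have hM0 : 0 < M := by linarith
  have hMr : 1 ≤ M ^ r := Real.one_le_rpow (by linarith) hr0.le
  have hpr0 : 0 < p ^ (-r) := by positivity
  have hprod : ∀ x : ℝ, M * D ≤ x → M ^ r * x ^ (-r) ≤ τ / 10^4 := by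
    intro x hx
    have : x ^ (-r) ≤ (M * D) ^ (-r) := Real.rpow_le_rpow_of_nonpos (by positivity) hx (by linarith)
    calc M ^ r * x ^ (-r) ≤ M ^ r * (M * D) ^ (-r) := by gcongr
      _ = (D ^ r)⁻¹ := by
        rw [Real.rpow_neg (by positivity), Real.mul_rpow hM0.le (by linarith)]
        field_simp
      _ ≤ _ := hDri
  have hNρ := hprod p hpC.le
  have hθ : τ / 3 ≤ τ/(2+τ) := by
    apply div_le_div_of_nonneg_left h0.le <;> linarith
  refine ⟨hp0, by linarith, by positivity, by nlinarith, by linarith, ?_⟩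
  intro m hm hlt
  have h2 : M * D ≤ p * (2 * m) := by
    rw [div_lt_iff₀ hp0] at hlt; linarith
  have h3 := hprod _ h2
  have e : M ^ r * p ^ (-r) * (2 * m) ^ ((1+τ)/(2+τ)) = M ^ r * (p * (2*m)) ^ (-r) * (2 * m) := by
    have : (1+τ)/(2+τ) = -r + 1 := by rw [hr]; field_simp; ring
    rw [this, Real.rpow_add_one (by positivity), Real.mul_rpow hp0.le (by positivity)]
    ring
  rw [mul_assoc, e]
  have := mul_le_mul_of_nonneg_right h3 (show 0 ≤ 2 * m by positivity)
  have := mul_le_mul_of_nonneg_right hθ hm.le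
  nlinarith [mul_pos h0 hm]

lemma root_ineq (τ p c x y X Y e T F Q : ℝ) (d : ℕ) (h0 : 0 < τ) (hp : 0 < p) (hc : 0 ≤ c)
    (hx : 0 ≤ x) (hy : 0 ≤ y) (hX : 0 < X) (hY : 0 < Y) (he : 0 ≤ e) (hexy : e ≤ x * y)
    (hT : 0 < T) (hF : p ^ d ≤ F) (hQ : 0 < Q)
    (h : (e / (x * y)) ^ (2+τ) * x * y * (F * Q) ≤ c * ((T / (X * Y)) ^ (2+τ) * X * Y * Q)) :
    e / T ≤ c ^ (1/(2+τ)) * ((x / X) * (y / Y)) ^ ((1+τ)/(2+τ)) * (p ^ (-(1/(2+τ)))) ^ d := by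
  rcases eq_or_lt_of_le he with he | he
  · rw [← he, zero_div]; positivity
  have hx' : 0 < x := lt_of_le_of_ne hx (by rintro rfl; simp at hexy; linarith)
  have hy' : 0 < y := lt_of_le_of_ne hy (by rintro rfl; simp at hexy; linarith)
  set z : ℝ := (x / X) * (y / Y) with hz
  have hz0 : 0 < z := by positivity
  set t : ℝ := e / T with ht
  have ht0 : 0 < t := by positivity
  set δ : ℝ := T / (X * Y) with hδ
  have hδ0 : 0 < δ := by positivity
  have e1 : e / (x * y) = δ * (t / z) := by rw [hδ, ht, hz]; field_simp
  rw [e1, Real.mul_rpow hδ0.le (by positivity), Real.div_rpow ht0.le hz0.le] at h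
  have ez : z ^ (2+τ) = z ^ (1+τ) * z := by
    rw [← Real.rpow_add_one hz0.ne']; congr 1; ring
  have exy : x * y = z * (X * Y) := by rw [hz]; field_simp
  have hpd : 0 < p ^ d := by positivity
  have hzs : 0 < z ^ (1+τ) := by positivity
  have h2 : t ^ (2+τ) * p ^ d ≤ c * z ^ (1+τ) := by
    have hfac : 0 < δ ^ (2+τ) * X * Y * Q := by positivity
    have h3 : (t ^ (2+τ) / z ^ (1+τ) * F) * (δ ^ (2+τ) * X * Y * Q) ≤
        c * (δ ^ (2+τ) * X * Y * Q) := by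
      refine le_trans (le_of_eq ?_) h
      rw [ez]
      have : δ ^ (2 + τ) * (t ^ (2 + τ) / (z ^ (1 + τ) * z)) * x * y * (F * Q) =
        δ ^ (2 + τ) * (t ^ (2 + τ) / (z ^ (1 + τ) * z)) * (x * y) * (F * Q) := by ring
      rw [this, exy]; field_simp
    have h4 := le_of_mul_le_mul_right h3 hfac
    have h5 : t ^ (2+τ) / z ^ (1+τ) * p ^ d ≤ c :=
      le_trans (mul_le_mul_of_nonneg_left hF (by positivity)) h4
    rw [div_mul_eq_mul_div, div_le_iff₀ hzs] at h5
    exact h5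
  have h6 : t ^ (2+τ) ≤ c * z ^ (1+τ) * (p ^ d)⁻¹ := by
    rw [← div_eq_mul_inv, le_div_iff₀ hpd]; exact h2
  have h7 := Real.rpow_le_rpow (z := 1/(2+τ)) (by positivity) h6 (by positivity)
  rw [← Real.rpow_mul ht0.le, mul_one_div_cancel (by linarith), Real.rpow_one,
    Real.mul_rpow (by positivity) (by positivity), Real.mul_rpow hc hzs.le,
    ← Real.rpow_mul hz0.le, mul_one_div, Real.inv_rpow hpd.le] at h7
  refine h7.trans (le_of_eq ?_)
  congr 1
  rw [Real.rpow_neg hp.le, inv_pow, ← Real.rpow_natCast, ← Real.rpow_mul hp.le,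
    ← Real.rpow_natCast, ← Real.rpow_mul hp.le, mul_comm]

namespace GCDGraph

lemma muSet_nonneg (G : GCDGraph) (S : Finset ℕ) : 0 ≤ muSet G.mu S :=
  sum_nonneg fun n _ => G.mu_nonneg n

lemma muEdges_nonneg (G : GCDGraph) (S : Finset (ℕ × ℕ)) : 0 ≤ muEdges G.mu S :=
  sum_nonneg fun n _ => mul_nonneg (G.mu_nonneg _) (G.mu_nonneg _)

lemma density_nonneg (G : GCDGraph) : 0 ≤ G.density :=
  div_nonneg (muEdges_nonneg _ _) (mul_nonneg (muSet_nonneg _ _) (muSet_nonneg _ _))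

/-- sub-triple as a GCD graph -/
def sub (G : GCDGraph) (V W : Finset ℕ) (E : Finset (ℕ × ℕ)) (hV : V ⊆ G.V) (hW : W ⊆ G.W)
    (hE : E ⊆ G.E) (hEVW : E ⊆ V ×ˢ W) : GCDGraph where
  mu := G.mu
  mu_nonneg := G.mu_nonneg
  V := V
  W := W
  V_pos := fun v hv => G.V_pos v (hV hv)
  W_pos := fun v hv => G.W_pos v (hW hv)
  E := E
  E_sub := hEVW
  P := G.P
  P_prime := G.P_prime
  f := G.f
  g := G.g
  f_dvd := fun p hp v hv => G.f_dvd p hp v (hV hv)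
  g_dvd := fun p hp v hv => G.g_dvd p hp v (hW hv)
  gcd_exact := fun p hp e he => G.gcd_exact p hp e (hE he)

lemma quality_sub (τ : ℝ) (G : GCDGraph) (V W : Finset ℕ) (E : Finset (ℕ × ℕ)) (hV : V ⊆ G.V)
    (hW : W ⊆ G.W) (hE : E ⊆ G.E) (hEVW : E ⊆ V ×ˢ W) :
    quality τ (G.sub V W E hV hW hE hEVW) = qualityRaw τ G.mu V W E G.P G.f G.g := rfl

lemma exists_max (τ : ℝ) (G : GCDGraph) : ∃ G' : GCDGraph, IsSubgraph G' G ∧ G'.P = G.P ∧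
    G'.f = G.f ∧ G'.g = G.g ∧ quality τ G ≤ quality τ G' ∧ IsMaximal τ G' := by
  classical
  obtain ⟨S, hS⟩ : ∃ S : Finset (Finset ℕ × Finset ℕ × Finset (ℕ × ℕ)),
      ∀ t, t ∈ S ↔ (t.1 ⊆ G.V ∧ t.2.1 ⊆ G.W ∧ t.2.2 ⊆ G.E) ∧ t.2.2 ⊆ t.1 ×ˢ t.2.1 := by
    refine ⟨(G.V.powerset ×ˢ G.W.powerset ×ˢ G.E.powerset).filter
      fun t => t.2.2 ⊆ t.1 ×ˢ t.2.1, fun t => ?_⟩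
    simp only [mem_filter, mem_product, mem_powerset]
  have hG : (G.V, G.W, G.E) ∈ S := by
    rw [hS]; exact ⟨⟨Subset.rfl, Subset.rfl, Subset.rfl⟩, G.E_sub⟩
  obtain ⟨t, ht, hmax⟩ := exists_max_image S
    (fun t => qualityRaw τ G.mu t.1 t.2.1 t.2.2 G.P G.f G.g) ⟨_, hG⟩
  have ht' := (hS t).1 ht
  refine ⟨G.sub t.1 t.2.1 t.2.2 ht'.1.1 ht'.1.2.1 ht'.1.2.2 ht'.2, ?_, rfl, rfl, rfl, ?_, ?_⟩
  · exact ⟨rfl, ht'.1.1, ht'.1.2.1, ht'.1.2.2, Subset.rfl, fun _ _ => rfl, fun _ _ => rfl⟩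
  · rw [quality_sub]
    have h := hmax _ hG
    simp only at h
    unfold quality
    exact h
  · intro H hH hP
    obtain ⟨hmu, hV, hW, hE, -, hf, hg⟩ := hH
    have hm := hmax (H.V, H.W, H.E) ((hS _).2
      ⟨⟨hV.trans ht'.1.1, hW.trans ht'.1.2.1, hE.trans ht'.1.2.2⟩, H.E_sub⟩)
    simp only at hm
    rw [quality_sub]
    refine le_trans (le_of_eq ?_) hm
    change H.mu = G.mu at hmu
    change H.P = G.P at hP
    simp only [quality, qualityRaw, hmu, hP]
    congr 1
    refine prod_congr rfl fun q hq => ?_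
    have h1 : H.f q = G.f q := hf q hq
    have h2 : H.g q = G.g q := hg q hq
    rw [h1, h2]

lemma gcd_exact_of {p k l a b : ℕ} (ha : p ^ k ∣ a ∧ ¬ p ^ (k+1) ∣ a)
    (hb : p ^ l ∣ b ∧ ¬ p ^ (l+1) ∣ b) :
    p ^ min k l ∣ Nat.gcd a b ∧ ¬ p ^ (min k l + 1) ∣ Nat.gcd a b := by
  constructor
  · exact Nat.dvd_gcd ((pow_dvd_pow p (min_le_left k l)).trans ha.1)
      ((pow_dvd_pow p (min_le_right k l)).trans hb.1)
  · intro h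
    rcases le_total k l with hkl | hkl
    · rw [min_eq_left hkl] at h
      exact ha.2 (h.trans (Nat.gcd_dvd_left _ _))
    · rw [min_eq_right hkl] at h
      exact hb.2 (h.trans (Nat.gcd_dvd_right _ _))

/-- The graph `G_{p^k,p^l}`. -/
def restr (G : GCDGraph) (p k l : ℕ) (hp : p.Prime) (hpP : p ∉ G.P) : GCDGraph where
  mu := G.mu
  mu_nonneg := G.mu_nonneg
  V := exactPart G.V p k
  W := exactPart G.W p l
  V_pos := fun v hv => G.V_pos v (mem_filter.1 hv).1
  W_pos := fun v hv => G.W_pos v (mem_filter.1 hv).1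
  E := edgesAt G p k l
  E_sub := fun e he => mem_product.2 (mem_filter.1 he).2
  P := insert p G.P
  P_prime := fun q hq => by
    rcases mem_insert.1 hq with rfl | hq
    · exact hp
    · exact G.P_prime q hq
  f := Function.update G.f p k
  g := Function.update G.g p l
  f_dvd := fun q hq v hv => by
    rcases mem_insert.1 hq with rfl | hq'
    · rw [Function.update_self]; exact (mem_filter.1 hv).2.1
    · rw [Function.update_of_ne (by rintro rfl; exact hpP hq')]
      exact G.f_dvd q hq' v (mem_filter.1 hv).1
  g_dvd := fun q hq v hv => by
    rcases mem_insert.1 hq with rfl | hq'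
    · rw [Function.update_self]; exact (mem_filter.1 hv).2.1
    · rw [Function.update_of_ne (by rintro rfl; exact hpP hq')]
      exact G.g_dvd q hq' v (mem_filter.1 hv).1
  gcd_exact := fun q hq e he => by
    rcases mem_insert.1 hq with rfl | hq'
    · rw [Function.update_self, Function.update_self]
      have h := (mem_filter.1 he).2
      exact gcd_exact_of (mem_filter.1 h.1).2 (mem_filter.1 h.2).2
    · have : q ≠ p := by rintro rfl; exact hpP hq'
      rw [Function.update_of_ne this, Function.update_of_ne this]
      exact G.gcd_exact q hq' e (mem_filter.1 he).1

/-- local factor -/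
noncomputable def fac (τ : ℝ) (f g : ℕ → ℕ) (p : ℕ) : ℝ :=
  ((p : ℝ) ^ (((f p : ℤ) - (g p : ℤ)).natAbs) *
      ((1 - (if f p = g p ∧ 1 ≤ f p then ((p : ℝ))⁻¹ else 0))⁻¹) ^ 2 *
      ((1 - (p : ℝ) ^ (-1 - τ / 4))⁻¹) ^ 3)

lemma fac_ge (τ : ℝ) (h0 : 0 < τ) (f g : ℕ → ℕ) (p : ℕ) (hp : p.Prime) :
    (p : ℝ) ^ (((f p : ℤ) - (g p : ℤ)).natAbs) ≤ fac τ f g p := by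
  have hp1 : (1:ℝ) < p := by exact_mod_cast hp.one_lt
  have aux : ∀ x : ℝ, 0 ≤ x → x < 1 → 1 ≤ (1 - x)⁻¹ := fun x h1 h2 =>
    (one_le_inv₀ (by linarith)).2 (by linarith)
  have h1 : 1 ≤ ((1 - (if f p = g p ∧ 1 ≤ f p then ((p : ℝ))⁻¹ else 0))⁻¹) ^ 2 := by
    apply one_le_pow₀
    apply aux
    · split_ifs <;> positivity
    · split_ifs
      · exact inv_lt_one_of_one_lt₀ hp1
      · norm_num
  have h2 : 1 ≤ ((1 - (p : ℝ) ^ (-1 - τ / 4))⁻¹) ^ 3 := by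
    apply one_le_pow₀
    apply aux
    · positivity
    · exact Real.rpow_lt_one_of_one_lt_of_neg hp1 (by linarith)
  unfold fac
  have h3 : 0 ≤ (p : ℝ) ^ (((f p : ℤ) - (g p : ℤ)).natAbs) := by positivity
  calc _ = (p : ℝ) ^ (((f p : ℤ) - (g p : ℤ)).natAbs) * 1 * 1 := by ring
    _ ≤ _ := by gcongr

lemma fac_pos (τ : ℝ) (h0 : 0 < τ) (f g : ℕ → ℕ) (p : ℕ) (hp : p.Prime) : 0 < fac τ f g p :=
  lt_of_lt_of_le (by have := hp.pos; positivity) (fac_ge τ h0 f g p hp)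

lemma quality_eq (τ : ℝ) (G : GCDGraph) : quality τ G =
    (muEdges G.mu G.E / (muSet G.mu G.V * muSet G.mu G.W)) ^ (2 + τ) * muSet G.mu G.V * muSet G.mu G.W *
      ∏ p ∈ G.P, fac τ G.f G.g p := rfl

lemma qualityAt_eq (τ : ℝ) (G : GCDGraph) (p k l : ℕ) (hpP : p ∉ G.P) : qualityAt τ G p k l =
    (muEdges G.mu (edgesAt G p k l) / (muSet G.mu (exactPart G.V p k) * muSet G.mu (exactPart G.W p l))) ^ (2 + τ)
      * muSet G.mu (exactPart G.V p k) * muSet G.mu (exactPart G.W p l) *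
      (fac τ (Function.update G.f p k) (Function.update G.g p l) p * ∏ p ∈ G.P, fac τ G.f G.g p) := by
  have : ∏ q ∈ insert p G.P, fac τ (Function.update G.f p k) (Function.update G.g p l) q =
      fac τ (Function.update G.f p k) (Function.update G.g p l) p * ∏ p ∈ G.P, fac τ G.f G.g p := by
    rw [prod_insert hpP]
    congr 1
    refine prod_congr rfl fun q hq => ?_
    have : q ≠ p := by rintro rfl; exact hpP hq
    simp only [fac, Function.update_of_ne this]
  rw [← this]
  rfl

lemma exact_iff {p k v : ℕ} (hp : p.Prime) (hv : 0 < v) :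
    (p ^ k ∣ v ∧ ¬ p ^ (k+1) ∣ v) ↔ v.factorization p = k := by
  rw [hp.pow_dvd_iff_le_factorization hv.ne', hp.pow_dvd_iff_le_factorization hv.ne']
  omega

lemma exactPart_eq {p : ℕ} (hp : p.Prime) (S : Finset ℕ) (hS : ∀ v ∈ S, 0 < v) (k : ℕ) :
    exactPart S p k = S.filter fun v => v.factorization p = k := by
  unfold exactPart
  exact filter_congr fun v hv => exact_iff hp (hS v hv)

lemma sum_exact {p : ℕ} (hp : p.Prime) (mu : ℕ → ℝ) (S : Finset ℕ) (hS : ∀ v ∈ S, 0 < v) (n : ℕ)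
    (hn : ∀ v ∈ S, v.factorization p < n) :
    ∑ k ∈ range n, muSet mu (exactPart S p k) = muSet mu S := by
  unfold muSet
  simp only [exactPart_eq hp S hS]
  exact sum_fiberwise_of_maps_to (fun v hv => mem_range.2 (hn v hv)) _

lemma sum_edges {p : ℕ} (hp : p.Prime) (G : GCDGraph) (n : ℕ)
    (hV : ∀ v ∈ G.V, v.factorization p < n) (hW : ∀ v ∈ G.W, v.factorization p < n) :
    ∑ k ∈ range n, ∑ l ∈ range n, muEdges G.mu (edgesAt G p k l) = muEdges G.mu G.E := by
  unfold muEdges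
  have hE : ∀ e ∈ G.E, e.1 ∈ G.V ∧ e.2 ∈ G.W := fun e he => mem_product.1 (G.E_sub he)
  rw [← sum_product', ← sum_fiberwise_of_maps_to (s := G.E) (t := range n ×ˢ range n)
    (g := fun e => (e.1.factorization p, e.2.factorization p))]
  · refine sum_congr rfl fun kl _ => ?_
    refine sum_congr ?_ fun _ _ => rfl
    unfold edgesAt
    refine filter_congr fun e he => ?_
    rw [exactPart_eq hp _ G.V_pos, exactPart_eq hp _ G.W_pos, mem_filter, mem_filter, Prod.ext_iff]
    simp [(hE e he).1, (hE e he).2]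
  · intro e he
    simp only [mem_product, mem_range]
    exact ⟨hV _ (hE e he).1, hW _ (hE e he).2⟩

lemma edges_le (G : GCDGraph) (p k l : ℕ) : muEdges G.mu (edgesAt G p k l) ≤
    muSet G.mu (exactPart G.V p k) * muSet G.mu (exactPart G.W p l) := by
  unfold muEdges muSet
  rw [sum_mul_sum, ← sum_product']
  refine sum_le_sum_of_subset_of_nonneg (fun e he => mem_product.2 (mem_filter.1 he).2) ?_
  intro e _ _
  exact mul_nonneg (G.mu_nonneg _) (G.mu_nonneg _)

lemma exists_good (τ M : ℝ) (h0 : 0 < τ) (h1 : τ < 1 / 100) (hM : 2 ≤ M)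
    (G : GCDGraph) (hδ : 0 < G.density) (p : ℕ) (hpR : p ∈ R G)
    (hp6 : C6 τ M < (p : ℝ)) (hflat : p ∉ Rsharp τ M G) :
    ∃ k l, (if k = l then 1 else M) * quality τ G ≤ qualityAt τ G p k l := by
  by_cases hab : ∃ a b : ℕ, a ≠ b ∧ M * quality τ G ≤ qualityAt τ G p a b
  · obtain ⟨a, b, hne, h⟩ := hab
    exact ⟨a, b, by rwa [if_neg hne]⟩
  by_contra hcon
  push Not at hcon hab
  have hnc : ∀ k : ℕ, ¬ (1 - C2 τ M / (p : ℝ) ≤ muSet G.mu (exactPart G.V p k) / muSet G.mu G.V ∧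
        1 - C2 τ M / (p : ℝ) ≤ muSet G.mu (exactPart G.W p k) / muSet G.mu G.W) :=
    fun k hk => hflat ⟨hpR, ⟨k, hk⟩, hab⟩
  obtain ⟨hp, hpP, -⟩ := hpR
  obtain ⟨hp0, hp1, hC, hρ, hε, hm⟩ := consts τ M p h0 h1 hM hp6
  have hX : 0 < muSet G.mu G.V := by
    refine lt_of_le_of_ne (muSet_nonneg _ _) fun h => ?_
    simp [density, densityRaw, ← h] at hδ
  have hY : 0 < muSet G.mu G.W := by
    refine lt_of_le_of_ne (muSet_nonneg _ _) fun h => ?_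
    simp [density, densityRaw, ← h] at hδ
  have hT : 0 < muEdges G.mu G.E := by
    refine lt_of_le_of_ne (muEdges_nonneg _ _) fun h => ?_
    simp [density, densityRaw, ← h] at hδ
  have hQ : 0 < ∏ q ∈ G.P, fac τ G.f G.g q := prod_pos fun q hq => fac_pos τ h0 _ _ q (G.P_prime q hq)
  set n := (G.V ∪ G.W).sup (fun v => v.factorization p) + 1 with hn
  have hnV : ∀ v ∈ G.V, v.factorization p < n := fun v hv =>
    Nat.lt_succ_of_le (le_sup (f := fun v => v.factorization p) (mem_union_left _ hv))
  have hnW : ∀ v ∈ G.W, v.factorization p < n := fun v hv =>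
    Nat.lt_succ_of_le (le_sup (f := fun v => v.factorization p) (mem_union_right _ hv))
  have K := key ((1+τ)/(2+τ)) (τ/(2+τ)) ((p:ℝ) ^ (-(1/(2+τ)))) (M ^ (1/(2+τ))) (C2 τ M / p)
    (by field_simp; ring) (by positivity) (by rw [div_le_one (by linarith)]; linarith)
    (by positivity) hρ (by positivity) hε hC hm n
    (fun k => muSet G.mu (exactPart G.V p k) / muSet G.mu G.V)
    (fun k => muSet G.mu (exactPart G.W p k) / muSet G.mu G.W)
    (fun k => div_nonneg (muSet_nonneg _ _) hX.le)
    (fun k => div_nonneg (muSet_nonneg _ _) hY.le)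
    (by rw [← sum_div, sum_exact hp _ _ G.V_pos n hnV, div_self hX.ne'])
    (by rw [← sum_div, sum_exact hp _ _ G.W_pos n hnW, div_self hY.ne'])
    hnc
  refine absurd K (not_lt.2 ?_)
  have tot : ∑ k ∈ range n, ∑ l ∈ range n, muEdges G.mu (edgesAt G p k l) / muEdges G.mu G.E = 1 := by
    simp only [← sum_div]
    rw [sum_edges hp G n hnV hnW, div_self hT.ne']
  refine tot.symm.le.trans ?_
  refine sum_le_sum fun k _ => sum_le_sum fun l _ => ?_
  have hq := (hcon k l).le
  rw [quality_eq, qualityAt_eq _ _ _ _ _ hpP] at hq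
  have hF := fac_ge τ h0 (Function.update G.f p k) (Function.update G.g p l) p hp
  rw [Function.update_self, Function.update_self] at hF
  have := root_ineq τ p _ _ _ _ _ _ _ _ _ _ h0 hp0 (by split_ifs <;> linarith) (muSet_nonneg _ _)
    (muSet_nonneg _ _) hX hY (muEdges_nonneg _ _) (edges_le G p k l) hT hF hQ hq
  refine this.trans (le_of_eq ?_)
  split_ifs with hkl
  · subst hkl; simp
  · rfl

end GCDGraph

/-- Iteration when `R♭(G) ≠ ∅` (Proposition 7.7 / `IterationStep1`). -/
theorem iteration_step_one (τ M : ℝ) (hτ : τ ∈ Set.Ioo (0 : ℝ) (1 / 100)) (hM : 2 ≤ M)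
    (G : GCDGraph) (hδ : 0 < G.density)
    (hR : ∀ p ∈ R G, C6 τ M < (p : ℝ))
    (hflat : (Rflat τ M G).Nonempty) :
    ∃ G' : GCDGraph, IsSubgraph G' G ∧ 0 < G'.density ∧
      IsMaximal τ G' ∧
      G.P ⊂ G'.P ∧ (↑G'.P : Set ℕ) ⊆ ↑G.P ∪ R G ∧
      R G' ⊂ R G ∧
      M ^ ((G'.P \ G.P).filter (fun p => G'.f p ≠ G'.g p)).card * quality τ G ≤
        quality τ G' ∧
      ∀ p ∈ G'.P, p ∉ G.P →
        (∀ v ∈ G'.V, p ^ G'.f p ∣ v ∧ ¬ p ^ (G'.f p + 1) ∣ v) ∧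
        (∀ w ∈ G'.W, p ^ G'.g p ∣ w ∧ ¬ p ^ (G'.g p + 1) ∣ w) := by
  obtain ⟨h0, h1⟩ := hτ
  obtain ⟨p, hpR, hps⟩ := hflat
  obtain ⟨k, l, hkl⟩ := exists_good τ M h0 h1 hM G hδ p hpR (hR p hpR) hps
  obtain ⟨hp, hpP, hpe⟩ := id hpR
  obtain ⟨G', hsub, hP', hf', hg', hq', hmax⟩ := exists_max τ (G.restr p k l hp hpP)
  have hqq : qualityAt τ G p k l ≤ quality τ G' := hq'
  obtain ⟨smu, sV, sW, sE, -, -, -⟩ := hsub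
  change G'.P = insert p G.P at hP'
  change G'.f = Function.update G.f p k at hf'
  change G'.g = Function.update G.g p l at hg'
  have sV' : G'.V ⊆ exactPart G.V p k := sV
  have sW' : G'.W ⊆ exactPart G.W p l := sW
  have sE' : G'.E ⊆ G.E := sE.trans (filter_subset _ _)
  have hne : ∀ q ∈ G.P, q ≠ p := by rintro q hq rfl; exact hpP hq
  have hqG : 0 < quality τ G := by
    have hX : 0 < muSet G.mu G.V := by
      refine lt_of_le_of_ne (muSet_nonneg _ _) fun h => ?_
      simp [density, densityRaw, ← h] at hδ
    have hY : 0 < muSet G.mu G.W := by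
      refine lt_of_le_of_ne (muSet_nonneg _ _) fun h => ?_
      simp [density, densityRaw, ← h] at hδ
    have hQ : 0 < ∏ q ∈ G.P, fac τ G.f G.g q :=
      prod_pos fun q hq => fac_pos τ h0 _ _ q (G.P_prime q hq)
    have hd : 0 < (muEdges G.mu G.E / (muSet G.mu G.V * muSet G.mu G.W)) := hδ
    rw [quality_eq]
    positivity
  have hqG' : 0 < quality τ G' := by
    refine lt_of_lt_of_le ?_ (hkl.trans hqq)
    refine mul_pos ?_ hqG
    split_ifs <;> linarith
  refine ⟨G', ⟨smu, sV'.trans (filter_subset _ _), sW'.trans (filter_subset _ _), sE', ?_, ?_, ?_⟩,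
    ?_, hmax, ?_, ?_, ?_, ?_, ?_⟩
  · rw [hP']; exact subset_insert _ _
  · intro q hq; rw [hf', Function.update_of_ne (hne q hq)]
  · intro q hq; rw [hg', Function.update_of_ne (hne q hq)]
  · refine lt_of_le_of_ne (density_nonneg _) fun h => ?_
    have : quality τ G' = 0 := by
      have hh : densityRaw G'.mu G'.V G'.W G'.E = 0 := h.symm
      simp only [quality, qualityRaw, hh]
      rw [Real.zero_rpow (by linarith)]
      simp
    linarith
  · rw [hP']; exact ssubset_insert hpP
  · rw [hP']
    intro q hq
    rcases mem_insert.1 (mem_coe.1 hq) with rfl | hq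
    · exact Or.inr hpR
    · exact Or.inl hq
  · refine ⟨?_, fun h => ?_⟩
    · rintro q ⟨hq, hqP, e, he, hd⟩
      rw [hP', mem_insert, not_or] at hqP
      exact ⟨hq, hqP.2, e, sE' he, hd⟩
    · have := (h hpR).2.1
      rw [hP'] at this
      exact this (mem_insert_self _ _)
  · refine le_trans (le_of_eq ?_) (hkl.trans hqq)
    congr 1
    have : G'.P \ G.P = {p} := by
      rw [hP']
      ext q
      simp only [mem_sdiff, mem_insert, mem_singleton]
      constructor
      · rintro ⟨h | h, h'⟩
        · exact h
        · exact absurd h h'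
      · rintro rfl; exact ⟨Or.inl rfl, hpP⟩
    rw [this, filter_singleton, hf', hg', Function.update_self, Function.update_self]
    by_cases h : k = l <;> simp [h]
  · intro q hq hqP
    rw [hP'] at hq
    obtain rfl : q = p := by
      rcases mem_insert.1 hq with h | h
      · exact h
      · exact absurd h hqP
    rw [hf', hg', Function.update_self, Function.update_self]
    exact ⟨fun v hv => (mem_filter.1 (sV' hv)).2, fun w hw => (mem_filter.1 (sW' hw)).2⟩
end

section
/- Let G = (μ,V,W,E,P,f,g) be a GCD graph with edge density δ > 0 such that R(G) ⊆ {p : p > C₆}, R♭(G) = ∅ and R♯(G) ≠ ∅. Then there is a GCD subgraph G' = (μ,V',W',E',P',f',g') of G such that P ⊊ P' ⊆ P ∪ R(G), R(G') ⊊ R(G), and q(G') ≥ q(G). -/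
open Finset

open GCDGraph


lemma aux_geo1 (D : Finset ℕ) : ∑ d ∈ D, (1/2 : ℝ) ^ d ≤ 2 := by
  have := Summable.sum_le_tsum D (fun i _ => by positivity) summable_geometric_two
  rwa [tsum_geometric_two] at this

lemma aux_geo (J : Finset ℕ) (i : ℕ) :
    ∑ j ∈ J, (1/2 : ℝ) ^ (((i : ℤ) - (j : ℤ)).natAbs) ≤ 4 := by
  rw [← Finset.sum_filter_add_sum_filter_not J (fun j => i ≤ j)]
  have h1 : ∑ j ∈ J with i ≤ j, (1/2 : ℝ) ^ (((i : ℤ) - (j : ℤ)).natAbs) ≤ 2 := by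
    rw [← Finset.sum_image (f := fun d => (1/2 : ℝ) ^ d)
      (g := fun j : ℕ => ((i : ℤ) - (j : ℤ)).natAbs)]
    · exact aux_geo1 _
    · intro a ha b hb hab
      simp at ha hb hab
      omega
  have h2 : ∑ j ∈ J with ¬ i ≤ j, (1/2 : ℝ) ^ (((i : ℤ) - (j : ℤ)).natAbs) ≤ 2 := by
    rw [← Finset.sum_image (f := fun d => (1/2 : ℝ) ^ d)
      (g := fun j : ℕ => ((i : ℤ) - (j : ℤ)).natAbs)]
    · exact aux_geo1 _
    · intro a ha b hb hab
      simp at ha hb hab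
      omega
  linarith

lemma aux_exp {s : ℝ} (h0 : 0 ≤ s) (h1 : s ≤ 1/2) : Real.exp (-(s + s^2)) ≤ 1 - s := by
  have h := Real.quadratic_le_exp_of_nonneg (x := s + s^2) (by positivity)
  have hp := Real.exp_pos (s + s^2)
  rw [Real.exp_neg, inv_le_iff_one_le_mul₀ hp]
  have : 1 ≤ (1 - s) * (1 + (s + s^2) + (s+s^2)^2/2) := by
    have e : (1 - s) * (1 + (s + s^2) + (s+s^2)^2/2) = 1 + s^2 * ((1-s)*(1+s)^2 - 2*s)/2 := by ring
    rw [e]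
    have : 0 ≤ (1-s)*(1+s)^2 - 2*s := by nlinarith [mul_nonneg h0 (sub_nonneg.2 h1), mul_nonneg (mul_nonneg h0 h0) (sub_nonneg.2 h1)]
    have := mul_nonneg (sq_nonneg s) this
    linarith
  nlinarith

lemma aux_B {τ A D1 D2 a b x y t ε κ : ℝ} (hτ : 0 < τ) (hτ1 : τ < 1/100)
    (hD1 : 0 ≤ D1) (hD2 : 0 ≤ D2) (h1 : D1 ≤ 1 - a) (h2 : D2 ≤ 1 - b)
    (hx : 0 ≤ x) (hy : 0 ≤ y) (ht : 0 ≤ t)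
    (hA : 1 - (x + y + t) ≤ A) (hs : x + y + t ≤ 1/2)
    (hε1 : ε < 1) (hκ1 : κ < 1)
    (hxy : (2 + τ) * (x + y) ≤ 2 * ε + (1 + τ) * (a + b))
    (hκ : t + (x + y + t)^2 ≤ κ) :
    (D1 * D2) ^ (1 + τ) ≤ A ^ (2 + τ) * (((1 - ε)⁻¹) ^ 2 * ((1 - κ)⁻¹) ^ 3) := by
  have e1 : (D1 * D2) ^ (1 + τ) ≤ Real.exp (-(a + b) * (1 + τ)) := by
    rw [Real.exp_mul]
    apply Real.rpow_le_rpow (by positivity) _ (by linarith)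
    have : -(a+b) = -a + -b := by ring
    rw [this, Real.exp_add]
    have := Real.add_one_le_exp (-a)
    have := Real.add_one_le_exp (-b)
    apply mul_le_mul (by linarith) (by linarith) hD2 (Real.exp_pos _).le
  have e2 : Real.exp (-((x+y+t) + (x+y+t)^2) * (2+τ)) ≤ A ^ (2 + τ) := by
    rw [Real.exp_mul]
    apply Real.rpow_le_rpow (Real.exp_pos _).le _ (by linarith)
    exact (aux_exp (by positivity) hs).trans hA
  have key : ∀ z : ℝ, z < 1 → Real.exp z ≤ (1 - z)⁻¹ := by
    intro z hz
    rw [le_inv_comm₀ (Real.exp_pos _) (by linarith), ← Real.exp_neg]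
    have := Real.add_one_le_exp (-z)
    linarith
  have e3 : Real.exp (2 * ε) ≤ ((1 - ε)⁻¹) ^ 2 := by
    have := pow_le_pow_left₀ (Real.exp_pos _).le (key ε hε1) 2
    rwa [← Real.exp_nat_mul] at this
  have e4 : Real.exp (3 * κ) ≤ ((1 - κ)⁻¹) ^ 3 := by
    have := pow_le_pow_left₀ (Real.exp_pos _).le (key κ hκ1) 3
    rwa [← Real.exp_nat_mul] at this
  refine e1.trans ?_
  calc Real.exp (-(a + b) * (1 + τ)) ≤ Real.exp (-((x+y+t) + (x+y+t)^2) * (2+τ)) * (Real.exp (2 * ε) * Real.exp (3 * κ)) := by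
        rw [← Real.exp_add, ← Real.exp_add]
        apply Real.exp_le_exp.2
        have : 0 ≤ t + (x+y+t)^2 := by positivity
        nlinarith
    _ ≤ _ := by
        apply mul_le_mul e2 (mul_le_mul e3 e4 (Real.exp_pos _).le (by positivity)) (by positivity) ((Real.exp_pos _).le.trans e2)

lemma aux_rest {N k : ℕ} (α β : ℕ → ℝ) (e : ℕ → ℕ → ℝ) {u r θ : ℝ} (hk : k < N)
    (hα0 : ∀ i, 0 ≤ α i) (hβ0 : ∀ i, 0 ≤ β i)
    (hα : ∑ i ∈ range N, α i = 1) (hβ : ∑ i ∈ range N, β i = 1)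
    (hαk : 1 - u ≤ α k) (hβk : 1 - u ≤ β k)
    (hu : 0 < u) (hr0 : 0 ≤ r) (hr : r ≤ 1/2) (hθ : 1/2 ≤ θ) (_hθ1 : θ ≤ 1)
    (he : ∀ i j, e i j ≤ r ^ (((i : ℤ) - (j : ℤ)).natAbs) * (α i * β j) ^ θ)
    (T : Finset (ℕ × ℕ)) (hT : T ⊆ range N ×ˢ range N)
    (hT2 : ∀ q ∈ T, (q.1 ≠ k ∧ q.2 ≠ k) ∨ (q.1 = k ∧ 2 ≤ ((k : ℤ) - (q.2 : ℤ)).natAbs) ∨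
      (q.2 = k ∧ 2 ≤ ((k : ℤ) - (q.1 : ℤ)).natAbs)) :
    ∑ q ∈ T, e q.1 q.2 ≤ 4 * u ^ (2 * θ) + 32 * r ^ 2 * u ^ θ := by
  have gen : ∀ γ : ℕ → ℝ, (∀ i, 0 ≤ γ i) → ∑ i ∈ range N, γ i = 1 → 1 - u ≤ γ k →
      (∑ i ∈ range N, (if i = k then 0 else γ i) ≤ u) ∧ (∀ i ∈ range N, i ≠ k → γ i ≤ u) ∧
      (∀ i ∈ range N, γ i ≤ 1) := by
    intro γ h0 h1 h2
    have a1 : ∑ i ∈ range N, (if i = k then 0 else γ i) ≤ u := by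
      have : ∀ i ∈ range N, (if i = k then 0 else γ i) = γ i - (if i = k then γ k else 0) := by
        intro i _; split_ifs with h <;> simp [h]
      rw [Finset.sum_congr rfl this, Finset.sum_sub_distrib, h1, Finset.sum_ite_eq']
      simp [hk]; linarith
    refine ⟨a1, ?_, ?_⟩
    · intro i hi hik
      refine le_trans ?_ a1
      have := Finset.single_le_sum (f := fun i => if i = k then 0 else γ i) (s := range N)
        (fun j _ => by split_ifs <;> simp [h0]) hi
      simpa [hik] using this
    · intro i hi
      rw [← h1]
      exact Finset.single_le_sum (fun j _ => h0 j) hi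
  obtain ⟨sα, aα, bα⟩ := gen α hα0 hα hαk
  obtain ⟨sβ, aβ, bβ⟩ := gen β hβ0 hβ hβk
  set α' : ℕ → ℝ := fun i => if i = k then 0 else α i with hα'
  set β' : ℕ → ℝ := fun i => if i = k then 0 else β i with hβ'
  have α'0 : ∀ i, 0 ≤ α' i := fun i => by simp only [hα']; split_ifs <;> simp [hα0]
  have β'0 : ∀ i, 0 ≤ β' i := fun i => by simp only [hβ']; split_ifs <;> simp [hβ0]
  let w : ℕ → ℕ → ℝ := fun i j => (1/2 : ℝ) ^ (((i : ℤ) - (j : ℤ)).natAbs)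
  have wsymm : ∀ i j : ℕ, w i j = w j i := fun i j => by
    simp only [w]; congr 1; omega
  have w0 : ∀ i j, 0 ≤ w i j := fun i j => by positivity
  let B : ℕ × ℕ → ℝ := fun q => u ^ (2 * θ - 1) * (w q.1 q.2 * ((α' q.1 + β' q.2)/2)) +
    4 * r ^ 2 * u ^ θ * ((if q.1 = k then w k q.2 else 0) + (if q.2 = k then w k q.1 else 0))
  have hrw : ∀ i j : ℕ, r ^ (((i : ℤ) - (j : ℤ)).natAbs) ≤ w i j := fun i j =>
    pow_le_pow_left₀ hr0 hr _
  have uθ : 0 ≤ u ^ θ := by positivity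
  have hrd : ∀ d : ℕ, 2 ≤ d → r ^ d ≤ 4 * r^2 * (1/2)^d := by
    intro d hd
    obtain ⟨m, rfl⟩ := Nat.exists_eq_add_of_le hd
    rw [pow_add, pow_add]
    have := pow_le_pow_left₀ hr0 hr m
    nlinarith [sq_nonneg r]
  have hB0 : ∀ q, 0 ≤ B q := by
    intro q
    have := α'0 q.1
    have := β'0 q.2
    have := w0 q.1 q.2
    have := w0 k q.2
    have := w0 k q.1
    simp only [B]
    have h1 : (0:ℝ) ≤ (if q.1 = k then w k q.2 else 0) := by split_ifs <;> simp [*]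
    have h2 : (0:ℝ) ≤ (if q.2 = k then w k q.1 else 0) := by split_ifs <;> simp [*]
    positivity
  have hpt : ∀ q ∈ T, e q.1 q.2 ≤ B q := by
    rintro ⟨i, j⟩ hq
    have hmem := Finset.mem_product.1 (hT hq)
    obtain ⟨hi, hj⟩ := hmem
    change i ∈ range N at hi
    change j ∈ range N at hj
    refine (he i j).trans ?_
    rcases hT2 _ hq with ⟨h1, h2⟩ | ⟨h1, h2⟩ | ⟨h1, h2⟩
    · dsimp only at h1 h2
      have : (α i * β j) ^ θ ≤ u ^ (2 * θ - 1) * ((α i + β j) / 2) := by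
        have hp : 0 ≤ α i * β j := mul_nonneg (hα0 i) (hβ0 j)
        have e1 : (α i * β j) ^ θ = (α i * β j) ^ (θ - 1/2) * (α i * β j) ^ (1/2 : ℝ) := by
          rw [← Real.rpow_add_of_nonneg hp (by linarith) (by norm_num)]; congr 1; ring
        rw [e1]
        apply mul_le_mul _ _ (by positivity) (by positivity)
        · have : u ^ (2 * θ - 1) = (u * u) ^ (θ - 1/2) := by
            rw [Real.mul_rpow hu.le hu.le, ← Real.rpow_add hu]; congr 1; ring
          rw [this]
          exact Real.rpow_le_rpow hp (mul_le_mul (aα i hi h1) (aβ j hj h2) (hβ0 j) hu.le) (by linarith)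
        · rw [← Real.sqrt_eq_rpow]
          apply Real.sqrt_le_iff.2 ⟨by have := hα0 i; have := hβ0 j; positivity, ?_⟩
          nlinarith [sq_nonneg (α i - β j)]
      simp only [B, hα', hβ', h1, h2, if_false]
      calc _ ≤ w i j * (u ^ (2 * θ - 1) * ((α i + β j) / 2)) :=
            mul_le_mul (hrw i j) this (by have := hα0 i; have := hβ0 j; positivity) (w0 i j)
        _ = _ := by ring
    · dsimp only at h1 h2
      subst h1
      have hji : j ≠ i := by rintro rfl; simp at h2
      have : (α i * β j) ^ θ ≤ u ^ θ := by
        apply Real.rpow_le_rpow (mul_nonneg (hα0 i) (hβ0 j)) _ (by linarith)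
        have := mul_le_mul (bα i hi) (aβ j hj hji) (hβ0 j) zero_le_one
        linarith
      have h3 := mul_le_mul (hrd _ h2) this (by have := hα0 i; have := hβ0 j; positivity) (by positivity)
      refine h3.trans ?_
      simp only [B, hji, if_true, if_false, add_zero]
      have : 0 ≤ u ^ (2 * θ - 1) * (w i j * ((α' i + β' j)/2)) := by
        have := α'0 i
        have := β'0 j
        have := w0 i j
        positivity
      have e4 : 4 * r ^ 2 * (1 / 2) ^ ((i:ℤ) - (j:ℤ)).natAbs * u ^ θ = 4 * r^2 * u^θ * w (i : ℕ) (j : ℕ) := by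
        simp only [w]; ring
      linarith
    · dsimp only at h1 h2
      subst h1
      have hji : i ≠ j := by rintro rfl; simp at h2
      have : (α i * β j) ^ θ ≤ u ^ θ := by
        apply Real.rpow_le_rpow (mul_nonneg (hα0 i) (hβ0 j)) _ (by linarith)
        have := mul_le_mul (aα i hi hji) (bβ j hj) (hβ0 j) hu.le
        linarith
      have hs : ((i:ℤ) - (j:ℤ)).natAbs = ((j:ℤ) - (i:ℤ)).natAbs := by omega
      rw [hs]
      have h3 := mul_le_mul (hrd _ h2) this (by have := hα0 i; have := hβ0 j; positivity) (by positivity)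
      refine h3.trans ?_
      simp only [B, hji, if_true, if_false, zero_add]
      have : 0 ≤ u ^ (2 * θ - 1) * (w i j * ((α' i + β' j)/2)) := by
        have := α'0 i
        have := β'0 j
        have := w0 i j
        positivity
      have e4 : 4 * r ^ 2 * (1 / 2) ^ ((j:ℤ) - (i:ℤ)).natAbs * u ^ θ = 4 * r^2 * u^θ * w j i := by
        simp only [w]; ring
      linarith
  refine (Finset.sum_le_sum hpt).trans ?_
  refine (Finset.sum_le_sum_of_subset_of_nonneg hT (fun q _ _ => hB0 q)).trans ?_
  simp only [B]
  rw [Finset.sum_add_distrib, ← Finset.mul_sum, ← Finset.mul_sum, Finset.sum_add_distrib]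
  have S1 : ∑ q ∈ range N ×ˢ range N, w q.1 q.2 * ((α' q.1 + β' q.2) / 2) ≤ 4 * u := by
    have : ∀ q ∈ range N ×ˢ range N, w q.1 q.2 * ((α' q.1 + β' q.2) / 2) =
        (α' q.1 / 2) * w q.1 q.2 + (β' q.2 / 2) * w q.2 q.1 := by
      intro q _; rw [wsymm q.2 q.1]; ring
    rw [Finset.sum_congr rfl this, Finset.sum_add_distrib, Finset.sum_product, Finset.sum_product_right]
    simp only [← Finset.mul_sum]
    have A1 : ∀ γ : ℕ → ℝ, (∀ i, 0 ≤ γ i) → ∑ i ∈ range N, γ i ≤ u →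
        ∑ i ∈ range N, γ i / 2 * ∑ j ∈ range N, w i j ≤ 2 * u := by
      intro γ h0 h1
      calc _ ≤ ∑ i ∈ range N, γ i / 2 * 4 :=
            Finset.sum_le_sum fun i _ => mul_le_mul_of_nonneg_left (aux_geo _ i) (by have := h0 i; positivity)
        _ = 2 * ∑ i ∈ range N, γ i := by rw [Finset.mul_sum]; exact Finset.sum_congr rfl fun i _ => by ring
        _ ≤ _ := by linarith
    have := A1 α' α'0 sα
    have := A1 β' β'0 sβ
    linarith
  have S2 : ∑ q ∈ range N ×ˢ range N, (if q.1 = k then w k q.2 else 0) ≤ 4 := by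
    rw [Finset.sum_product_right]
    simp only [Finset.sum_ite_eq']
    simp only [Finset.mem_range, hk, if_true]
    exact aux_geo _ k
  have S3 : ∑ q ∈ range N ×ˢ range N, (if q.2 = k then w k q.1 else 0) ≤ 4 := by
    rw [Finset.sum_product]
    simp only [Finset.sum_ite_eq']
    simp only [Finset.mem_range, hk, if_true]
    exact aux_geo _ k
  have hu2 : u ^ (2 * θ) = u ^ (2 * θ - 1) * u := by
    rw [← Real.rpow_add_one hu.ne']; congr 1; ring
  rw [hu2]
  have := mul_le_mul_of_nonneg_left S1 (show 0 ≤ u ^ (2*θ - 1) by positivity)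
  have := mul_le_mul_of_nonneg_left (add_le_add S2 S3) (show 0 ≤ 4 * r^2 * u ^ θ by positivity)
  linarith

lemma aux_num {τ c p : ℝ} (hτ : 0 < τ) (hτ1 : τ < 1/100) (hc : 100 ≤ c) (hp : c ^ (10/τ) < p) :
    4 * (c/p) ^ (2 * ((1+τ)/(2+τ))) + 32 * (p ^ (-1/(2+τ))) ^ 2 * (c/p) ^ ((1+τ)/(2+τ)) + 9 * (c/p)^2
      ≤ p ^ (-1 - τ/4) ∧ p ^ (-1-τ/4) ≤ 1/p ∧ 1/p ≤ c/p ∧ c/p ≤ 1/100 ∧ p ^ (-1/(2+τ)) ≤ 1/2 ∧ 1 < p := by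
  have hcp : c ^ 3 < p := by
    have h3 : c ^ (3:ℝ) ≤ c ^ (10/τ) := by
      apply Real.rpow_le_rpow_of_exponent_le (by linarith)
      rw [le_div_iff₀ hτ]; linarith
    have h : c ^ (3:ℝ) = c ^ (3:ℕ) := by exact_mod_cast Real.rpow_natCast c 3
    rw [h] at h3
    exact lt_of_le_of_lt h3 hp
  have hcc : 10000 * c ≤ c ^ 3 := by nlinarith [mul_nonneg (show 0 ≤ c by linarith) (mul_nonneg (sub_nonneg.2 hc) (show 0 ≤ c by linarith)), mul_nonneg (show 0 ≤ c by linarith) (sub_nonneg.2 hc)]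
  have hp1 : 1 < p := by linarith
  have hp0 : 0 < p := by linarith
  have hc2 : c ≤ p ^ (τ/10) := by
    have := Real.rpow_le_rpow (by positivity) hp.le (show 0 ≤ τ/10 by positivity)
    rw [← Real.rpow_mul (by linarith)] at this
    have e : 10/τ * (τ/10) = 1 := by field_simp
    rwa [e, Real.rpow_one] at this
  have hu : c/p ≤ p ^ (τ/10 - 1) := by
    rw [Real.rpow_sub_one hp0.ne']
    exact div_le_div_of_nonneg_right hc2 hp0.le
  have hu0 : 0 < c/p := by positivity
  have hu1 : c/p ≤ 1/100 := by
    rw [div_le_div_iff₀ hp0 (by norm_num)]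
    linarith
  have hτ2 : 0 < 2 + τ := by linarith
  have hκ : p ^ (-1 - τ/4 - τ/10) ≤ p ^ (-1-τ/4) / c := by
    rw [Real.rpow_sub hp0]
    exact div_le_div_of_nonneg_left (by positivity) (by linarith) hc2
  have E1 : (c/p) ^ (2 * ((1+τ)/(2+τ))) ≤ p ^ (-1-τ/4) / c := by
    refine le_trans ?_ hκ
    refine (Real.rpow_le_rpow hu0.le hu (by positivity)).trans ?_
    rw [← Real.rpow_mul hp0.le]
    apply Real.rpow_le_rpow_of_exponent_le hp1.le
    have : (τ / 10 - 1) * (2 * ((1 + τ) / (2 + τ))) = ((τ/10 - 1) * (2 * (1+τ))) / (2+τ) := by ring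
    rw [this, div_le_iff₀ hτ2]
    nlinarith
  have E2 : (p ^ (-1/(2+τ))) ^ 2 * (c/p) ^ ((1+τ)/(2+τ)) ≤ p ^ (-1-τ/4) / c := by
    refine le_trans ?_ hκ
    refine (mul_le_mul_of_nonneg_left (Real.rpow_le_rpow hu0.le hu (by positivity)) (by positivity)).trans ?_
    rw [← Real.rpow_mul hp0.le, ← Real.rpow_mul_natCast hp0.le, ← Real.rpow_add hp0]
    apply Real.rpow_le_rpow_of_exponent_le hp1.le
    have : -1 / (2 + τ) * ((2:ℕ):ℝ) + (τ / 10 - 1) * ((1 + τ) / (2 + τ)) = (-2 + (τ/10 - 1) * (1+τ)) / (2+τ) := by push_cast; ring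
    rw [this, div_le_iff₀ hτ2]
    nlinarith
  have E3 : (c/p)^2 ≤ (c/p) ^ (2 * ((1+τ)/(2+τ))) := by
    rw [← Real.rpow_natCast]
    apply Real.rpow_le_rpow_of_exponent_ge hu0 (by linarith)
    push_cast
    have : (1+τ)/(2+τ) ≤ 1 := by rw [div_le_one hτ2]; linarith
    linarith
  have hk0 : 0 < p ^ (-1-τ/4) := by positivity
  have E4 : 45 * (p ^ (-1-τ/4) / c) ≤ p ^ (-1-τ/4) := by
    rw [mul_div_assoc', div_le_iff₀ (by linarith)]
    nlinarith
  refine ⟨by linarith, ?_, ?_, hu1, ?_, hp1⟩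
  · rw [one_div, ← Real.rpow_neg_one]
    apply Real.rpow_le_rpow_of_exponent_le hp1.le; linarith
  · apply div_le_div_of_nonneg_right (by linarith) hp0.le
  · have h : p ^ (-1/(2+τ)) ≤ p ^ (-(1/3) : ℝ) := by
      apply Real.rpow_le_rpow_of_exponent_le hp1.le
      rw [div_le_iff₀ hτ2]; linarith
    refine h.trans ?_
    rw [Real.rpow_neg hp0.le, one_div (2:ℝ)]
    apply inv_anti₀ (by norm_num)
    have : (8:ℝ) ^ (1/3:ℝ) = 2 := by
      rw [show (8:ℝ) = 2 ^ (3:ℝ) by norm_num, ← Real.rpow_mul (by norm_num)]; norm_num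
    rw [← this]
    apply Real.rpow_le_rpow (by norm_num) _ (by norm_num)
    linarith

lemma aux_main {N k : ℕ} (α β : ℕ → ℝ) (e : ℕ → ℕ → ℝ) {τ c p : ℝ} (hk : k + 1 < N)
    (hτ : 0 < τ) (hτ1 : τ < 1/100) (hc : 100 ≤ c) (hp : c ^ (10/τ) < p)
    (hα0 : ∀ i, 0 ≤ α i) (hβ0 : ∀ i, 0 ≤ β i) (he0 : ∀ i j, 0 ≤ e i j)
    (hα : ∑ i ∈ range N, α i = 1) (hβ : ∑ i ∈ range N, β i = 1)
    (hes : ∑ q ∈ range N ×ˢ range N, e q.1 q.2 = 1)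
    (hαk : 1 - c/p ≤ α k) (hβk : 1 - c/p ≤ β k)
    (he : ∀ i j, e i j ≤ (p ^ (-1/(2+τ))) ^ (((i : ℤ) - (j : ℤ)).natAbs) * (α i * β j) ^ ((1+τ)/(2+τ))) :
    ((α k + α (k+1)) * (β k + β (k+1))) ^ (1 + τ) ≤
      (e k k + e k (k+1) + e (k+1) k) ^ (2 + τ) *
        (((1 - (if 1 ≤ k then p⁻¹ else 0))⁻¹) ^ 2 * ((1 - p ^ (-1 - τ/4))⁻¹) ^ 3) := by
  obtain ⟨n1, n2, n3, n4, n5, n6⟩ := aux_num hτ hτ1 hc hp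
  have hp0 : 0 < p := by linarith
  have hτ2 : 0 < 2 + τ := by linarith
  set u := c/p with hu
  set r := p ^ (-1/(2+τ)) with hr
  set θ := (1+τ)/(2+τ) with hθ
  set κ := p ^ (-1-τ/4) with hκ
  have hu0 : 0 < u := lt_of_lt_of_le (by positivity) n3
  have hr0 : 0 ≤ r := by positivity
  have hθh : 1/2 ≤ θ := by rw [hθ, div_le_div_iff₀ (by norm_num) hτ2]; linarith
  have hθ1 : θ ≤ 1 := by rw [hθ, div_le_one hτ2]; linarith
  have rest := aux_rest α β e (show k < N by omega) hα0 hβ0 hα hβ hαk hβk hu0 hr0 n5 hθh hθ1 he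
  have hα1 : ∀ J ⊆ range N, ∑ i ∈ J, α i ≤ 1 := fun J hJ => by
    rw [← hα]; exact Finset.sum_le_sum_of_subset_of_nonneg hJ fun i _ _ => hα0 i
  have hβ1 : ∀ J ⊆ range N, ∑ i ∈ J, β i ≤ 1 := fun J hJ => by
    rw [← hβ]; exact Finset.sum_le_sum_of_subset_of_nonneg hJ fun i _ _ => hβ0 i
  set t := 4 * u ^ (2 * θ) + 32 * r ^ 2 * u ^ θ with ht
  have ht0 : 0 ≤ t := by positivity
  have htu : t ≤ u := by have := sq_nonneg u; linarith
  have hpinv : p⁻¹ = 1/p := by simp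
  set S := range N ×ˢ range N with hS
  set A : Finset (ℕ × ℕ) := {(k,k), (k,k+1), (k+1,k)} with hA
  have hAsum : ∑ q ∈ A, e q.1 q.2 = e k k + e k (k+1) + e (k+1) k := by
    rw [hA, Finset.sum_insert (by simp), Finset.sum_insert (by simp), Finset.sum_singleton]; ring
  have hsplit : ∀ B : Finset (ℕ × ℕ), 1 ≤ ∑ q ∈ A, e q.1 q.2 + ∑ q ∈ B, e q.1 q.2 + ∑ q ∈ S \ (A ∪ B), e q.1 q.2 := by
    intro B
    rw [← hes]
    have h1 : ∑ q ∈ S, e q.1 q.2 ≤ ∑ q ∈ (A ∪ B) ∪ (S \ (A ∪ B)), e q.1 q.2 :=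
      Finset.sum_le_sum_of_subset_of_nonneg (by intro q hq; simp only [Finset.mem_union, Finset.mem_sdiff]; tauto) fun q _ _ => he0 _ _
    have h2 : ∀ X Y : Finset (ℕ × ℕ), ∑ q ∈ X ∪ Y, e q.1 q.2 ≤ ∑ q ∈ X, e q.1 q.2 + ∑ q ∈ Y, e q.1 q.2 := by
      intro X Y
      rw [← Finset.sum_union_inter]
      have : 0 ≤ ∑ q ∈ X ∩ Y, e q.1 q.2 := Finset.sum_nonneg fun q _ => he0 _ _
      linarith
    have h3 := h2 (A ∪ B) (S \ (A ∪ B))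
    have h4 := h2 A B
    linarith
  have hD1 : 0 ≤ α k + α (k+1) := add_nonneg (hα0 _) (hα0 _)
  have hD2 : 0 ≤ β k + β (k+1) := add_nonneg (hβ0 _) (hβ0 _)
  rcases Nat.eq_zero_or_pos k with rfl | hkpos
  · have hsp := hsplit ∅
    have hrest := rest (S \ (A ∪ ∅)) Finset.sdiff_subset (by
      rintro ⟨i, j⟩ hq
      simp [hA] at hq
      simp only
      omega)
    rw [hAsum] at hsp
    simp only [Finset.sum_empty] at hsp
    have a1 := hα1 {0, 1} (by intro x; simp; omega)
    have b1 := hβ1 {0, 1} (by intro x; simp; omega)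
    rw [Finset.sum_pair (by simp)] at a1 b1
    have := aux_B (A := e 0 0 + e 0 (0+1) + e (0+1) 0) (D1 := α 0 + α (0+1)) (D2 := β 0 + β (0+1))
      (a := 0) (b := 0) (x := 0) (y := 0) (t := t) (ε := 0) (κ := κ) hτ hτ1 hD1 hD2
      (by simpa using a1) (by simpa using b1) le_rfl le_rfl ht0 (by linarith)
      (by linarith) (by norm_num) (by linarith) (by norm_num)
      (by
        have : (0 + 0 + t)^2 ≤ u^2 := pow_le_pow_left₀ (by positivity) (by linarith) 2
        have := sq_nonneg u
        linarith)
    simpa using this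
  · obtain ⟨m, rfl⟩ : ∃ m, k = m + 1 := ⟨k - 1, by omega⟩
    have hsp := hsplit {(m+1, m), (m, m+1)}
    have hrest := rest (S \ (A ∪ {(m+1, m), (m, m+1)})) Finset.sdiff_subset (by
      rintro ⟨i, j⟩ hq
      simp [hA] at hq
      simp only
      omega)
    rw [hAsum, Finset.sum_pair (by simp)] at hsp
    dsimp only at hsp
    have hsub : ({m, m+1, m+1+1} : Finset ℕ) ⊆ range N := by intro x; simp; omega
    have a1 := hα1 _ hsub
    have b1 := hβ1 _ hsub
    rw [Finset.sum_insert (by simp; omega), Finset.sum_pair (by simp)] at a1 b1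
    have am : ∀ b : ℝ, 0 ≤ b → (2+τ) * (r * b ^ θ) ≤ 1/p + (1+τ) * b := by
      intro b hb
      have h := Real.geom_mean_le_arith_mean2_weighted (w₁ := 1/(2+τ)) (w₂ := θ) (p₁ := 1/p) (p₂ := b)
        (by positivity) (by positivity) (by positivity) hb (by rw [hθ]; field_simp; ring)
      have e1 : (1/p) ^ (1/(2+τ)) = r := by
        rw [hr, one_div p, Real.inv_rpow hp0.le, ← Real.rpow_neg hp0.le]; congr 1; ring
      rw [e1] at h
      have h2 := mul_le_mul_of_nonneg_left h hτ2.le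
      have e2 : (2+τ) * (1/(2+τ) * (1/p) + θ * b) = 1/p + (1+τ) * b := by rw [hθ]; field_simp
      linarith
    have hx : (2+τ) * e (m+1) m ≤ 1/p + (1+τ) * β m := by
      refine le_trans (mul_le_mul_of_nonneg_left ?_ hτ2.le) (am _ (hβ0 m))
      refine (he _ _).trans ?_
      have : (((m+1 : ℕ) : ℤ) - (m : ℤ)).natAbs = 1 := by omega
      rw [this, pow_one]
      apply mul_le_mul_of_nonneg_left _ hr0
      apply Real.rpow_le_rpow (mul_nonneg (hα0 _) (hβ0 _)) _ (by linarith)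
      have : α (m+1) ≤ 1 := by have := hα0 m; have := hα0 (m+1+1); linarith
      have := mul_le_mul_of_nonneg_right this (hβ0 m)
      linarith
    have hy : (2+τ) * e m (m+1) ≤ 1/p + (1+τ) * α m := by
      refine le_trans (mul_le_mul_of_nonneg_left ?_ hτ2.le) (am _ (hα0 m))
      refine (he _ _).trans ?_
      have : ((m : ℤ) - ((m+1 : ℕ) : ℤ)).natAbs = 1 := by omega
      rw [this, pow_one]
      apply mul_le_mul_of_nonneg_left _ hr0
      apply Real.rpow_le_rpow (mul_nonneg (hα0 _) (hβ0 _)) _ (by linarith)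
      have : β (m+1) ≤ 1 := by have := hβ0 m; have := hβ0 (m+1+1); linarith
      have := mul_le_mul_of_nonneg_left this (hα0 m)
      linarith
    have ha : α m ≤ u := by have := hα0 (m+1+1); linarith
    have hb : β m ≤ u := by have := hβ0 (m+1+1); linarith
    have hxy : e (m+1) m + e m (m+1) ≤ 2 * u := by
      have h1 := mul_le_mul_of_nonneg_left ha (show 0 ≤ 1+τ by linarith)
      have h2 := mul_le_mul_of_nonneg_left hb (show 0 ≤ 1+τ by linarith)
      have : (2+τ) * (e (m+1) m + e m (m+1)) ≤ (2+τ) * (2*u) := by nlinarith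
      exact le_of_mul_le_mul_left this hτ2
    have hx0 := he0 (m+1) m
    have hy0 := he0 m (m+1)
    have := aux_B (A := e (m+1) (m+1) + e (m+1) (m+1+1) + e (m+1+1) (m+1)) (D1 := α (m+1) + α (m+1+1)) (D2 := β (m+1) + β (m+1+1))
      (a := α m) (b := β m) (x := e (m+1) m) (y := e m (m+1)) (t := t) (ε := p⁻¹) (κ := κ) hτ hτ1 hD1 hD2
      (by linarith) (by linarith) hx0 hy0 ht0 (by linarith)
      (by linarith) (by linarith) (by linarith) (by rw [hpinv]; linarith)
      (by
        have : (e (m+1) m + e m (m+1) + t)^2 ≤ (3*u)^2 := pow_le_pow_left₀ (by positivity) (by linarith) 2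
        have e3 : (3*u)^2 = 9*u^2 := by ring
        linarith)
    simpa using this

lemma aux_core {τ mE mV mW m A B : ℝ} (hE : 0 < mE) (hV : 0 < mV) (hW : 0 < mW)
    (hm : 0 ≤ m) (hA : 0 < A) (hB : 0 < B) :
    ((m / (A * B)) ^ (2+τ) * A * B) * (A/mV * (B/mW)) ^ (1+τ) =
      ((mE / (mV * mW)) ^ (2+τ) * mV * mW) * (m/mE) ^ (2+τ) := by
  have h1 : m / (A*B) = (mE / (mV * mW)) * (m/mE) / (A/mV * (B/mW)) := by field_simp
  have hab : 0 < A/mV * (B/mW) := by positivity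
  rw [h1, Real.div_rpow (by positivity) hab.le, Real.mul_rpow (by positivity) (by positivity)]
  have h2 : (A/mV * (B/mW)) ^ (2+τ) = (A/mV * (B/mW)) ^ (1+τ) * (A/mV * (B/mW)) := by
    rw [← Real.rpow_add_one hab.ne']; congr 1; ring
  rw [h2]
  have : 0 < (A/mV * (B/mW)) ^ (1+τ) := by positivity
  field_simp

noncomputable def auxFac (τ : ℝ) (p k l : ℕ) : ℝ :=
  (p : ℝ) ^ (((k : ℤ) - (l : ℤ)).natAbs) *
      ((1 - (if k = l ∧ 1 ≤ k then ((p : ℝ))⁻¹ else 0))⁻¹) ^ 2 *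
      ((1 - (p : ℝ) ^ (-1 - τ / 4))⁻¹) ^ 3

lemma aux_kappa {τ : ℝ} (hτ : 0 < τ) {p : ℕ} (hp : p.Prime) :
    0 < (p : ℝ) ^ (-1 - τ / 4) ∧ (p : ℝ) ^ (-1 - τ / 4) < 1 := by
  have h1 : (1:ℝ) < p := by exact_mod_cast hp.one_lt
  exact ⟨by positivity, Real.rpow_lt_one_of_one_lt_of_neg h1 (by linarith)⟩

lemma aux_ind {p : ℕ} (hp : p.Prime) (k l : ℕ) :
    0 ≤ (if k = l ∧ 1 ≤ k then ((p : ℝ))⁻¹ else 0) ∧ (if k = l ∧ 1 ≤ k then ((p : ℝ))⁻¹ else 0) < 1 := by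
  have h1 : (1:ℝ) < p := by exact_mod_cast hp.one_lt
  split_ifs
  · exact ⟨by positivity, inv_lt_one_of_one_lt₀ h1⟩
  · norm_num

lemma auxFac_pos {τ : ℝ} (hτ : 0 < τ) {p : ℕ} (hp : p.Prime) (k l : ℕ) : 0 < auxFac τ p k l := by
  obtain ⟨a, b⟩ := aux_kappa hτ hp
  obtain ⟨c, d⟩ := aux_ind hp k l
  have h0 : (0:ℝ) < p := by exact_mod_cast hp.pos
  have := sub_pos.2 b
  have := sub_pos.2 d
  unfold auxFac
  positivity

lemma auxFac_ge {τ : ℝ} (hτ : 0 < τ) {p : ℕ} (hp : p.Prime) (k l : ℕ) :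
    (p : ℝ) ^ (((k : ℤ) - (l : ℤ)).natAbs) ≤ auxFac τ p k l := by
  obtain ⟨a, b⟩ := aux_kappa hτ hp
  obtain ⟨c, d⟩ := aux_ind hp k l
  have h0 : (0:ℝ) < p := by exact_mod_cast hp.pos
  unfold auxFac
  have e1 : 1 ≤ ((1 - (if k = l ∧ 1 ≤ k then ((p : ℝ))⁻¹ else 0))⁻¹) ^ 2 :=
    one_le_pow₀ ((one_le_inv₀ (by linarith)).2 (by linarith))
  have e2 : 1 ≤ ((1 - (p : ℝ) ^ (-1 - τ / 4))⁻¹) ^ 3 :=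
    one_le_pow₀ ((one_le_inv₀ (by linarith)).2 (by linarith))
  have h3 : 0 ≤ (p : ℝ) ^ (((k : ℤ) - (l : ℤ)).natAbs) := by positivity
  calc _ ≤ (p : ℝ) ^ (((k : ℤ) - (l : ℤ)).natAbs) * ((1 - (if k = l ∧ 1 ≤ k then ((p : ℝ))⁻¹ else 0))⁻¹) ^ 2 :=
        le_mul_of_one_le_right h3 e1
    _ ≤ _ := le_mul_of_one_le_right (by positivity) e2

lemma aux_ext {τ : ℝ} (hτ : 0 < τ) (G : GCDGraph) {p : ℕ} (hp : p ∈ R G)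
    (V' W' : Finset ℕ) (E' : Finset (ℕ × ℕ)) (k l : ℕ) (hV : V' ⊆ G.V) (hW : W' ⊆ G.W)
    (hE : E' ⊆ G.E) (hE' : E' ⊆ V' ×ˢ W') (hdV : ∀ v ∈ V', p ^ k ∣ v) (hdW : ∀ w ∈ W', p ^ l ∣ w)
    (hex : ∀ e ∈ E', ¬ p ^ (min k l + 1) ∣ Nat.gcd e.1 e.2)
    (hq : densityRaw G.mu G.V G.W G.E ^ (2 + τ) * muSet G.mu G.V * muSet G.mu G.W ≤
      (densityRaw G.mu V' W' E' ^ (2 + τ) * muSet G.mu V' * muSet G.mu W') * auxFac τ p k l) :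
    ∃ G' : GCDGraph, IsSubgraph G' G ∧
      G.P ⊂ G'.P ∧ (↑G'.P : Set ℕ) ⊆ ↑G.P ∪ R G ∧
      R G' ⊂ R G ∧
      quality τ G ≤ quality τ G' := by
  obtain ⟨hpp, hpP, hpe⟩ := id hp
  have hne : ∀ q ∈ G.P, q ≠ p := fun q hq h => hpP (h ▸ hq)
  let G' : GCDGraph :=
    { mu := G.mu
      mu_nonneg := G.mu_nonneg
      V := V'
      W := W'
      V_pos := fun v hv => G.V_pos v (hV hv)
      W_pos := fun v hv => G.W_pos v (hW hv)
      E := E'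
      E_sub := hE'
      P := insert p G.P
      P_prime := by
        intro q hq
        rcases Finset.mem_insert.1 hq with rfl | h
        · exact hpp
        · exact G.P_prime q h
      f := Function.update G.f p k
      g := Function.update G.g p l
      f_dvd := by
        intro q hq v hv
        rcases Finset.mem_insert.1 hq with rfl | h
        · simpa using hdV v hv
        · rw [Function.update_of_ne (hne q h)]; exact G.f_dvd q h v (hV hv)
      g_dvd := by
        intro q hq v hv
        rcases Finset.mem_insert.1 hq with rfl | h
        · simpa using hdW v hv
        · rw [Function.update_of_ne (hne q h)]; exact G.g_dvd q h v (hW hv)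
      gcd_exact := by
        intro q hq e he
        rcases Finset.mem_insert.1 hq with rfl | h
        · rw [Function.update_self, Function.update_self]
          have hm := Finset.mem_product.1 (hE' he)
          exact ⟨Nat.dvd_gcd ((pow_dvd_pow q (min_le_left k l)).trans (hdV _ hm.1))
            ((pow_dvd_pow q (min_le_right k l)).trans (hdW _ hm.2)), hex e he⟩
        · rw [Function.update_of_ne (hne q h), Function.update_of_ne (hne q h)]
          exact G.gcd_exact q h e (hE he) }
  refine ⟨G', ⟨rfl, hV, hW, hE, Finset.subset_insert _ _, ?_, ?_⟩, Finset.ssubset_insert hpP, ?_, ?_, ?_⟩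
  · intro q hq; exact Function.update_of_ne (hne q hq) _ _
  · intro q hq; exact Function.update_of_ne (hne q hq) _ _
  · intro q hq
    rcases Finset.mem_insert.1 (Finset.mem_coe.1 hq) with rfl | h
    · exact Or.inr hp
    · exact Or.inl h
  · refine (Set.ssubset_iff_of_subset ?_).2 ⟨p, hp, fun h => h.2.1 (Finset.mem_insert_self _ _)⟩
    rintro q ⟨h1, h2, e, he, hd⟩
    exact ⟨h1, fun h => h2 (Finset.mem_insert_of_mem h), e, hE he, hd⟩
  · have hprod : 0 < ∏ q ∈ G.P, auxFac τ q (G.f q) (G.g q) :=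
      Finset.prod_pos fun q hq => auxFac_pos hτ (G.P_prime q hq) _ _
    have e1 : quality τ G = (densityRaw G.mu G.V G.W G.E ^ (2 + τ) * muSet G.mu G.V * muSet G.mu G.W) *
        ∏ q ∈ G.P, auxFac τ q (G.f q) (G.g q) := rfl
    have e2 : quality τ G' = (densityRaw G.mu V' W' E' ^ (2 + τ) * muSet G.mu V' * muSet G.mu W') *
        ∏ q ∈ insert p G.P, auxFac τ q (Function.update G.f p k q) (Function.update G.g p l q) := rfl
    rw [e1, e2, Finset.prod_insert hpP, Function.update_self, Function.update_self]
    have e3 : ∏ q ∈ G.P, auxFac τ q (Function.update G.f p k q) (Function.update G.g p l q) =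
        ∏ q ∈ G.P, auxFac τ q (G.f q) (G.g q) :=
      Finset.prod_congr rfl fun q hq => by
        rw [Function.update_of_ne (hne q hq), Function.update_of_ne (hne q hq)]
    rw [e3, ← mul_assoc]
    exact mul_le_mul_of_nonneg_right hq hprod.le

lemma aux_exact_iff {p v k : ℕ} (hp : p.Prime) (hv : 0 < v) :
    (p ^ k ∣ v ∧ ¬ p ^ (k+1) ∣ v) ↔ v.factorization p = k := by
  rw [hp.pow_dvd_iff_le_factorization hv.ne', hp.pow_dvd_iff_le_factorization hv.ne']
  omega

lemma aux_exactPart {S : Finset ℕ} {p : ℕ} (hp : p.Prime) (hS : ∀ v ∈ S, 0 < v) (k : ℕ) :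
    exactPart S p k = S.filter fun v => v.factorization p = k := by
  unfold exactPart
  exact Finset.filter_congr fun v hv => aux_exact_iff hp (hS v hv)

lemma aux_sumV {S : Finset ℕ} {p N : ℕ} (hp : p.Prime) (hS : ∀ v ∈ S, 0 < v) (mu : ℕ → ℝ)
    (hN : ∀ v ∈ S, v.factorization p < N) :
    ∑ i ∈ range N, muSet mu (exactPart S p i) = muSet mu S := by
  unfold muSet
  simp only [aux_exactPart hp hS]
  exact Finset.sum_fiberwise_of_maps_to (fun v hv => Finset.mem_range.2 (hN v hv)) _

lemma aux_edgesAt (G : GCDGraph) {p : ℕ} (hp : p.Prime) (i j : ℕ) :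
    edgesAt G p i j = G.E.filter fun e => (e.1.factorization p, e.2.factorization p) = (i, j) := by
  unfold edgesAt
  refine Finset.filter_congr fun e he => ?_
  have hm := Finset.mem_product.1 (G.E_sub he)
  rw [aux_exactPart hp G.V_pos, aux_exactPart hp G.W_pos]
  simp [hm.1, hm.2]

lemma aux_sumE (G : GCDGraph) {p N : ℕ} (hp : p.Prime)
    (hN : ∀ v ∈ G.V, v.factorization p < N) (hN' : ∀ v ∈ G.W, v.factorization p < N) :
    ∑ q ∈ range N ×ˢ range N, muEdges G.mu (edgesAt G p q.1 q.2) = muEdges G.mu G.E := by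
  unfold muEdges
  simp only [aux_edgesAt G hp]
  exact Finset.sum_fiberwise_of_maps_to (g := fun e : ℕ × ℕ => (e.1.factorization p, e.2.factorization p)) (fun e he => by
    have hm := Finset.mem_product.1 (G.E_sub he)
    simp [hN _ hm.1, hN' _ hm.2]) _

lemma aux_edges_le (mu : ℕ → ℝ) (h0 : ∀ n, 0 ≤ mu n) {V W : Finset ℕ} {E : Finset (ℕ × ℕ)}
    (h : E ⊆ V ×ˢ W) : muEdges mu E ≤ muSet mu V * muSet mu W := by
  unfold muEdges muSet
  rw [Finset.sum_mul_sum, ← Finset.sum_product']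
  exact Finset.sum_le_sum_of_subset_of_nonneg h fun e _ _ => mul_nonneg (h0 _) (h0 _)

lemma aux_edgesAt_sub (G : GCDGraph) (p i j : ℕ) :
    edgesAt G p i j ⊆ exactPart G.V p i ×ˢ exactPart G.W p j := by
  intro e he
  exact Finset.mem_product.2 (Finset.mem_filter.1 he).2

lemma aux_C2 {τ M : ℝ} (hτ : 0 < τ) (hτ1 : τ < 1/100) (hM : 2 ≤ M) : 100 ≤ C2 τ M := by
  unfold C2 C1
  have h : 100 ≤ 10^4/τ := by rw [le_div_iff₀ hτ]; linarith
  have := pow_le_pow_left₀ (by norm_num) h 3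
  nlinarith

/-- Iteration when `R♭(G) = ∅` and `R♯(G) ≠ ∅` (`IterationStep2`). -/
theorem iteration_step_two (τ M : ℝ) (hτ : τ ∈ Set.Ioo (0 : ℝ) (1 / 100)) (hM : 2 ≤ M)
    (G : GCDGraph) (hδ : 0 < G.density)
    (hR : ∀ p ∈ R G, C6 τ M < (p : ℝ))
    (hflat : Rflat τ M G = ∅)
    (hsharp : (Rsharp τ M G).Nonempty) :
    ∃ G' : GCDGraph, IsSubgraph G' G ∧
      G.P ⊂ G'.P ∧ (↑G'.P : Set ℕ) ⊆ ↑G.P ∪ R G ∧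
      R G' ⊂ R G ∧
      quality τ G ≤ quality τ G' := by
  obtain ⟨hτ0, hτ1⟩ := hτ
  obtain ⟨p, hpR, ⟨k, hVk, hWk⟩, -⟩ := hsharp
  have hpp : p.Prime := hpR.1
  have hc := aux_C2 hτ0 hτ1 hM
  have hpc : C2 τ M ^ (10/τ) < p :=
    lt_of_le_of_lt ((le_max_right _ _).trans (le_max_right _ _)) (hR p hpR)
  obtain ⟨-, -, -, hu1, -, hp1⟩ := aux_num hτ0 hτ1 hc hpc
  set mV := muSet G.mu G.V with hmV
  set mW := muSet G.mu G.W with hmW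
  set mE := muEdges G.mu G.E with hmE
  have muS0 : ∀ S : Finset ℕ, 0 ≤ muSet G.mu S := fun S => Finset.sum_nonneg fun n _ => G.mu_nonneg n
  have muE0 : ∀ S : Finset (ℕ × ℕ), 0 ≤ muEdges G.mu S := fun S =>
    Finset.sum_nonneg fun n _ => mul_nonneg (G.mu_nonneg _) (G.mu_nonneg _)
  have hδ' : 0 < mE / (mV * mW) := hδ
  have hV0 : 0 < mV := lt_of_le_of_ne (muS0 _) fun h => by simp [← h] at hδ'
  have hW0 : 0 < mW := lt_of_le_of_ne (muS0 _) fun h => by simp [← h] at hδ'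
  have hE0 : 0 < mE := lt_of_le_of_ne (muE0 _) fun h => by simp [← h] at hδ'
  have hcore : 0 < (mE / (mV * mW)) ^ (2 + τ) * mV * mW := by positivity
  by_contra hno
  set α : ℕ → ℝ := fun i => muSet G.mu (exactPart G.V p i) / mV with hα
  set β : ℕ → ℝ := fun i => muSet G.mu (exactPart G.W p i) / mW with hβ
  set e : ℕ → ℕ → ℝ := fun i j => muEdges G.mu (edgesAt G p i j) / mE with he
  have hα0 : ∀ i, 0 ≤ α i := fun i => div_nonneg (muS0 _) hV0.le
  have hβ0 : ∀ i, 0 ≤ β i := fun i => div_nonneg (muS0 _) hW0.le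
  have he0 : ∀ i j, 0 ≤ e i j := fun i j => div_nonneg (muE0 _) hE0.le
  set N := (∑ v ∈ G.V, v.factorization p) + (∑ v ∈ G.W, v.factorization p) + k + 2 with hN
  have hNV : ∀ v ∈ G.V, v.factorization p < N := fun v hv => by
    have := Finset.single_le_sum (f := fun v : ℕ => v.factorization p) (fun _ _ => Nat.zero_le _) hv
    omega
  have hNW : ∀ v ∈ G.W, v.factorization p < N := fun v hv => by
    have := Finset.single_le_sum (f := fun v : ℕ => v.factorization p) (fun _ _ => Nat.zero_le _) hv
    omega
  have hτ2 : 0 < 2 + τ := by linarith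
  have hp0 : (0:ℝ) < p := by linarith
  -- bound for each piece
  have hbd : ∀ i j, e i j ≤ ((p:ℝ) ^ (-1/(2+τ))) ^ (((i : ℤ) - (j : ℤ)).natAbs) * (α i * β j) ^ ((1+τ)/(2+τ)) := by
    intro i j
    set A := muSet G.mu (exactPart G.V p i) with hA
    set B := muSet G.mu (exactPart G.W p j) with hB
    set m := muEdges G.mu (edgesAt G p i j) with hm
    have hmAB : m ≤ A * B := aux_edges_le _ G.mu_nonneg (aux_edgesAt_sub G p i j)
    have hR0 : 0 ≤ ((p:ℝ) ^ (-1/(2+τ))) ^ (((i : ℤ) - (j : ℤ)).natAbs) * (α i * β j) ^ ((1+τ)/(2+τ)) := by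
      have := hα0 i
      have := hβ0 j
      positivity
    rcases (muS0 (exactPart G.V p i)).eq_or_lt with h0 | hA0
    · have : m = 0 := le_antisymm (by rw [hA, ← h0] at hmAB; simpa using hmAB) (muE0 _)
      have : e i j = 0 := by simp only [he]; rw [← hm, this, zero_div]
      rw [this]; exact hR0
    rcases (muS0 (exactPart G.W p j)).eq_or_lt with h0 | hB0
    · have : m = 0 := le_antisymm (by rw [hB, ← h0] at hmAB; simpa using hmAB) (muE0 _)
      have : e i j = 0 := by simp only [he]; rw [← hm, this, zero_div]
      rw [this]; exact hR0
    have hlt : (m / (A * B)) ^ (2+τ) * A * B * auxFac τ p i j < (mE / (mV * mW)) ^ (2 + τ) * mV * mW := by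
      by_contra hge
      refine hno (aux_ext hτ0 G hpR (exactPart G.V p i) (exactPart G.W p j) (edgesAt G p i j) i j
        (Finset.filter_subset _ _) (Finset.filter_subset _ _) (Finset.filter_subset _ _)
        (aux_edgesAt_sub G p i j) (fun v hv => (Finset.mem_filter.1 hv).2.1)
        (fun v hv => (Finset.mem_filter.1 hv).2.1) ?_ (not_lt.1 hge))
      intro x hx hd
      have hx' := Finset.mem_product.1 (aux_edgesAt_sub G p i j hx)
      rcases le_total i j with h | h
      · rw [min_eq_left h] at hd
        exact (Finset.mem_filter.1 hx'.1).2.2 (hd.trans (Nat.gcd_dvd_left _ _))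
      · rw [min_eq_right h] at hd
        exact (Finset.mem_filter.1 hx'.2).2.2 (hd.trans (Nat.gcd_dvd_right _ _))
    have hce := aux_core (τ := τ) hE0 hV0 hW0 (muE0 (edgesAt G p i j)) hA0 hB0
    have hab : 0 < α i * β j := mul_pos (div_pos hA0 hV0) (div_pos hB0 hW0)
    have h1 : e i j ^ (2+τ) * auxFac τ p i j ≤ (α i * β j) ^ (1+τ) := by
      have hab' : 0 < (α i * β j) ^ (1+τ) := by positivity
      have h2 := mul_lt_mul_of_pos_right hlt hab'
      have h3 : (mE / (mV * mW)) ^ (2 + τ) * mV * mW * (e i j ^ (2+τ) * auxFac τ p i j) =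
          (m / (A * B)) ^ (2+τ) * A * B * auxFac τ p i j * (α i * β j) ^ (1+τ) := by
        rw [← mul_assoc]
        change _ * (m / mE) ^ (2+τ) * _ = _ * (A / mV * (B / mW)) ^ (1+τ)
        rw [← hce]; ring
      rw [← h3] at h2
      exact (lt_of_mul_lt_mul_left h2 hcore.le).le
    set d := ((i : ℤ) - (j : ℤ)).natAbs with hd
    have h2 : e i j ^ (2+τ) * (p:ℝ) ^ d ≤ (α i * β j) ^ (1+τ) :=
      (mul_le_mul_of_nonneg_left (auxFac_ge hτ0 hpp i j) (Real.rpow_nonneg (he0 i j) _)).trans h1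
    have hpd : (0:ℝ) < (p:ℝ) ^ d := by positivity
    have h3 : e i j ^ (2+τ) ≤ (((p:ℝ) ^ (-1/(2+τ))) ^ d * (α i * β j) ^ ((1+τ)/(2+τ))) ^ (2+τ) := by
      rw [Real.mul_rpow (by positivity) (by positivity), ← Real.rpow_mul hab.le,
        div_mul_cancel₀ _ hτ2.ne']
      have : ((((p:ℝ) ^ (-1/(2+τ))) ^ d) ^ (2+τ)) = ((p:ℝ) ^ d)⁻¹ := by
        rw [← Real.rpow_natCast, ← Real.rpow_mul hp0.le, ← Real.rpow_mul hp0.le,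
          ← Real.rpow_natCast, ← Real.rpow_neg hp0.le]
        congr 1
        field_simp
      rw [this, inv_mul_eq_div, le_div_iff₀ hpd]
      exact h2
    exact (Real.rpow_le_rpow_iff (he0 i j) hR0 hτ2).1 h3
  have hmain := aux_main α β e (N := N) (k := k) (τ := τ) (c := C2 τ M) (p := p) (by omega) hτ0 hτ1 hc hpc
    hα0 hβ0 he0
    (by simp only [hα]; rw [← Finset.sum_div, aux_sumV hpp G.V_pos G.mu hNV, div_self hV0.ne'])
    (by simp only [hβ]; rw [← Finset.sum_div, aux_sumV hpp G.W_pos G.mu hNW, div_self hW0.ne'])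
    (by simp only [he]; rw [← Finset.sum_div, aux_sumE G hpp hNV hNW, div_self hE0.ne'])
    hVk hWk hbd
  -- the merged graph
  have hdisj : ∀ S : Finset ℕ, Disjoint (exactPart S p k) (exactPart S p (k+1)) := fun S =>
    Finset.disjoint_left.2 fun v h1 h2 => (Finset.mem_filter.1 h1).2.2 (Finset.mem_filter.1 h2).2.1
  have hmuU : ∀ S : Finset ℕ, muSet G.mu (exactPart S p k ∪ exactPart S p (k+1)) =
      muSet G.mu (exactPart S p k) + muSet G.mu (exactPart S p (k+1)) := fun S =>
    Finset.sum_union (hdisj S)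
  have hm1 : ∀ i j, ∀ x ∈ edgesAt G p i j, x.1 ∈ exactPart G.V p i ∧ x.2 ∈ exactPart G.W p j :=
    fun i j x hx => (Finset.mem_filter.1 hx).2
  have hEU : muEdges G.mu (edgesAt G p k k ∪ edgesAt G p k (k+1) ∪ edgesAt G p (k+1) k) =
      muEdges G.mu (edgesAt G p k k) + muEdges G.mu (edgesAt G p k (k+1)) +
        muEdges G.mu (edgesAt G p (k+1) k) := by
    unfold muEdges
    rw [Finset.sum_union, Finset.sum_union]
    · refine Finset.disjoint_left.2 fun x h1 h2 => ?_
      exact Finset.disjoint_left.1 (hdisj G.W) (hm1 _ _ _ h1).2 (hm1 _ _ _ h2).2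
    · refine Finset.disjoint_left.2 fun x h1 h2 => ?_
      rcases Finset.mem_union.1 h1 with h1 | h1
      · exact Finset.disjoint_left.1 (hdisj G.V) (hm1 _ _ _ h1).1 (hm1 _ _ _ h2).1
      · exact Finset.disjoint_left.1 (hdisj G.V) (hm1 _ _ _ h1).1 (hm1 _ _ _ h2).1
  have hsubEx : ∀ (S : Finset ℕ) i, exactPart S p i ⊆ S := fun S i => Finset.filter_subset _ _
  have hsubE : ∀ i j, edgesAt G p i j ⊆ G.E := fun i j => Finset.filter_subset _ _
  have hdv : ∀ S : Finset ℕ, ∀ v ∈ exactPart S p k ∪ exactPart S p (k+1), p ^ k ∣ v := by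
    intro S v hv
    rcases Finset.mem_union.1 hv with h | h
    · exact (Finset.mem_filter.1 h).2.1
    · exact (pow_dvd_pow p (Nat.le_succ k)).trans (Finset.mem_filter.1 h).2.1
  refine hno (aux_ext hτ0 G hpR (exactPart G.V p k ∪ exactPart G.V p (k+1))
    (exactPart G.W p k ∪ exactPart G.W p (k+1))
    (edgesAt G p k k ∪ edgesAt G p k (k+1) ∪ edgesAt G p (k+1) k) k k
    (Finset.union_subset (hsubEx _ _) (hsubEx _ _)) (Finset.union_subset (hsubEx _ _) (hsubEx _ _))
    (Finset.union_subset (Finset.union_subset (hsubE _ _) (hsubE _ _)) (hsubE _ _)) ?_ (hdv _) (hdv _) ?_ ?_)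
  · intro x hx
    rw [Finset.mem_product, Finset.mem_union, Finset.mem_union]
    rcases Finset.mem_union.1 hx with hx | hx
    · rcases Finset.mem_union.1 hx with hx | hx
      · have := hm1 _ _ _ hx; tauto
      · have := hm1 _ _ _ hx; tauto
    · have := hm1 _ _ _ hx; tauto
  · intro x hx hd
    rw [min_self] at hd
    have d1 := hd.trans (Nat.gcd_dvd_left _ _)
    have d2 := hd.trans (Nat.gcd_dvd_right _ _)
    rcases Finset.mem_union.1 hx with hx | hx
    · rcases Finset.mem_union.1 hx with hx | hx
      · exact (Finset.mem_filter.1 (hm1 _ _ _ hx).1).2.2 d1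
      · exact (Finset.mem_filter.1 (hm1 _ _ _ hx).1).2.2 d1
    · exact (Finset.mem_filter.1 (hm1 _ _ _ hx).2).2.2 d2
  · have hαk : 0 < α k := lt_of_lt_of_le (by linarith) hVk
    have hβk : 0 < β k := lt_of_lt_of_le (by linarith) hWk
    have hAk : 0 < muSet G.mu (exactPart G.V p k) := by
      have := mul_pos hαk hV0
      rwa [hα, div_mul_cancel₀ _ hV0.ne'] at this
    have hBk : 0 < muSet G.mu (exactPart G.W p k) := by
      have := mul_pos hβk hW0
      rwa [hβ, div_mul_cancel₀ _ hW0.ne'] at this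
    unfold densityRaw
    rw [hmuU, hmuU, hEU]
    set A := muSet G.mu (exactPart G.V p k) + muSet G.mu (exactPart G.V p (k+1)) with hA
    set B := muSet G.mu (exactPart G.W p k) + muSet G.mu (exactPart G.W p (k+1)) with hB
    set m := muEdges G.mu (edgesAt G p k k) + muEdges G.mu (edgesAt G p k (k+1)) +
        muEdges G.mu (edgesAt G p (k+1) k) with hm
    have hA0 : 0 < A := add_pos_of_pos_of_nonneg hAk (muS0 _)
    have hB0 : 0 < B := add_pos_of_pos_of_nonneg hBk (muS0 _)
    have hm0 : 0 ≤ m := add_nonneg (add_nonneg (muE0 _) (muE0 _)) (muE0 _)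
    have hce := aux_core (τ := τ) hE0 hV0 hW0 hm0 hA0 hB0
    have eA : α k + α (k+1) = A / mV := by rw [hA, add_div]
    have eB : β k + β (k+1) = B / mW := by rw [hB, add_div]
    have em : e k k + e k (k+1) + e (k+1) k = m / mE := by rw [hm, add_div, add_div]
    have eF : auxFac τ p k k = ((1 - (if 1 ≤ k then (p:ℝ)⁻¹ else 0))⁻¹) ^ 2 * ((1 - (p:ℝ) ^ (-1 - τ/4))⁻¹) ^ 3 := by
      simp [auxFac]
    rw [eA, eB, em, ← eF] at hmain
    have hab : 0 < (A / mV * (B / mW)) ^ (1+τ) := by positivity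
    have h2 := mul_le_mul_of_nonneg_left hmain hcore.le
    rw [← mul_assoc, ← hce] at h2
    refine le_of_mul_le_mul_right (h2.trans (le_of_eq ?_)) hab
    ring
end

section
/- Let G = (μ,V,W,E,P,f,g) be a GCD graph with edge density δ > 0 and let p ∈ R(G) be a prime with p > C₂. Then one of the following holds: (1) there is a GCD subgraph G' of G with multiplicative data (P',f',g') and edge density δ' > 0 such that: (a) G' is (P',f',g')-maximal; (b) P' = P ∪ {p}; (c) R(G') ⊆ R(G)\{p}; (d) q(G') ≥ M^{1_{f'(p)≠g'(p)}}·q(G); (e) p^{f'(p)} exactly divides v and p^{g'(p)} exactly divides w for all vertices v, w of G'. Or (2) there is some k ∈ ℤ_{≥0} such that μ(V_{p^k})/μ(V) ≥ 1 − C₂/p and μ(W_{p^k})/μ(W) ≥ 1 − C₂/p. -/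
open Finset

open GCDGraph


lemma aux_schur (N : ℕ) (x y φ ψ : ℕ → ℝ) (K : ℕ → ℕ → ℝ) (H : ℝ)
    (hK : ∀ k l, 0 ≤ K k l) (hKd : ∀ k, K k k = 0)
    (hrow : ∀ k ∈ range N, ∑ l ∈ range N, K k l ≤ H)
    (hcol : ∀ l ∈ range N, ∑ k ∈ range N, K k l ≤ H)
    (hφ : ∀ k ∈ range N, 0 ≤ φ k) (hψ : ∀ k ∈ range N, 0 ≤ ψ k)
    (hxy : ∀ k ∈ range N, ∀ l ∈ range N, k ≠ l → x k * y l ≤ φ k + ψ l) :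
    ∑ k ∈ range N, ∑ l ∈ range N, K k l * (x k * y l)
      ≤ H * (∑ k ∈ range N, φ k + ∑ l ∈ range N, ψ l) := by
  have h1 : ∑ k ∈ range N, ∑ l ∈ range N, K k l * (x k * y l)
      ≤ ∑ k ∈ range N, ∑ l ∈ range N, (K k l * φ k + K k l * ψ l) := by
    refine Finset.sum_le_sum fun k hk => Finset.sum_le_sum fun l hl => ?_
    by_cases hkl : k = l
    · subst hkl; simp [hKd]
    · have := mul_le_mul_of_nonneg_left (hxy k hk l hl hkl) (hK k l)
      linarith
  have h2 : ∑ k ∈ range N, ∑ l ∈ range N, K k l * φ k ≤ H * ∑ k ∈ range N, φ k := by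
    rw [Finset.mul_sum]
    refine Finset.sum_le_sum fun k hk => ?_
    rw [← Finset.sum_mul]
    exact mul_le_mul_of_nonneg_right (hrow k hk) (hφ k hk)
  have h3 : ∑ k ∈ range N, ∑ l ∈ range N, K k l * ψ l ≤ H * ∑ k ∈ range N, ψ k := by
    rw [Finset.mul_sum, Finset.sum_comm]
    refine Finset.sum_le_sum fun k hk => ?_
    rw [← Finset.sum_mul]
    exact mul_le_mul_of_nonneg_right (hcol k hk) (hψ k hk)
  simp only [Finset.sum_add_distrib] at h1
  linarith

lemma aux_bern (x t : ℝ) (hx : 0 ≤ x) (ht : 0 ≤ t) (ht1 : t ≤ 1) :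
    x ^ t ≤ 1 - t * (1 - x) := by
  have := rpow_one_add_le_one_add_mul_self (s := x - 1) (by linarith) ht ht1
  have e : 1 + (x - 1) = x := by ring
  rw [e] at this
  linarith

set_option maxHeartbeats 1000000 in
lemma aux_core_s18 (τ r η : ℝ) (hτ0 : 0 < τ) (hτ1 : τ < 1 / 100) (hr : r * (2 + τ) = 1) (N : ℕ)
    (α β : ℕ → ℝ) (hα : ∀ k, 0 ≤ α k) (hβ : ∀ k, 0 ≤ β k)
    (hα1 : ∑ k ∈ range N, α k = 1) (hβ1 : ∑ k ∈ range N, β k = 1)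
    (K : ℕ → ℕ → ℝ) (hη0 : 0 < η) (hη : η ≤ τ / 10 ^ 4)
    (hK : ∀ k l, 0 ≤ K k l) (hKd : ∀ k, K k k = 0)
    (hrow : ∀ k ∈ range N, ∑ l ∈ range N, K k l ≤ 3 * η)
    (hcol : ∀ l ∈ range N, ∑ k ∈ range N, K k l ≤ 3 * η)
    (h : 1 ≤ ∑ k ∈ range N, α k ^ (1 - r) * β k ^ (1 - r) +
      ∑ k ∈ range N, ∑ l ∈ range N, K k l * (α k ^ (1 - r) * β l ^ (1 - r))) :
    ∃ k, α k ≤ 1 ∧ β k ≤ 1 ∧ (1 - α k) ^ r ≤ 10 ^ 4 / τ * η ∧ (1 - β k) ^ r ≤ 10 ^ 4 / τ * η := by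
  have hr0 : 1 / 3 < r := by nlinarith
  have hr1 : r < 1 / 2 := by nlinarith
  have hsq : ∀ x : ℝ, 0 ≤ x → x ^ (1 - r) * x ^ (1 - r) = x * x ^ (τ * r) := by
    intro x hx
    rcases hx.eq_or_lt with rfl | hx
    · rw [Real.zero_rpow (by linarith)]; simp
    · rw [← Real.rpow_add hx]
      nth_rw 2 [← Real.rpow_one x]
      rw [← Real.rpow_add hx]
      congr 1; linarith
  have hτr : 0 < τ * r := by positivity
  have hτr1 : τ * r ≤ 1 := by nlinarith
  have hsq1 : ∀ x : ℝ, 0 ≤ x → x ≤ 1 → x ^ (1 - r) * x ^ (1 - r) ≤ x := by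
    intro x hx hx1
    rw [hsq x hx]
    have := Real.rpow_le_one hx hx1 hτr.le
    nlinarith
  have hαle : ∀ k ∈ range N, α k ≤ 1 := fun k hk => by
    rw [← hα1]; exact Finset.single_le_sum (fun i _ => hα i) hk
  have hβle : ∀ k ∈ range N, β k ≤ 1 := fun k hk => by
    rw [← hβ1]; exact Finset.single_le_sum (fun i _ => hβ i) hk
  -- crude step
  have hcrude : ∑ k ∈ range N, ∑ l ∈ range N, K k l * (α k ^ (1 - r) * β l ^ (1 - r)) ≤ 3 * η := by
    have h1 := aux_schur N (fun k => α k ^ (1 - r)) (fun k => β k ^ (1 - r)) (fun k => α k / 2)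
      (fun k => β k / 2) K (3 * η) hK hKd hrow hcol (fun k _ => by have := hα k; positivity)
      (fun k _ => by have := hβ k; positivity) (by
        intro k hk l hl _
        have h1 := hsq1 _ (hα k) (hαle k hk)
        have h2 := hsq1 _ (hβ l) (hβle l hl)
        nlinarith [sq_nonneg (α k ^ (1 - r) - β l ^ (1 - r))])
    rw [← Finset.sum_div, ← Finset.sum_div, hα1, hβ1] at h1
    linarith
  have hη' : 4 * η < 1 := by
    have : τ / 10 ^ 4 < 1 / 100 := by norm_num; linarith
    linarith
  have hsqrt : ∑ k ∈ range N, √(α k * β k) ≤ 1 := by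
    have : ∑ k ∈ range N, √(α k * β k) ≤ ∑ k ∈ range N, (α k / 2 + β k / 2) := by
      refine Finset.sum_le_sum fun k hk => ?_
      rw [Real.sqrt_le_left (by have := hα k; have := hβ k; positivity)]
      nlinarith [sq_nonneg (α k - β k)]
    rw [Finset.sum_add_distrib, ← Finset.sum_div, ← Finset.sum_div, hα1, hβ1] at this
    linarith
  obtain ⟨k₀, hk₀, hk₀lt⟩ : ∃ k ∈ range N,
      (1 - 4 * η) * √(α k * β k) < α k ^ (1 - r) * β k ^ (1 - r) := by
    apply Finset.exists_lt_of_sum_lt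
    rw [← Finset.mul_sum]
    have : (1 - 4 * η) * ∑ k ∈ range N, √(α k * β k) ≤ (1 - 4 * η) * 1 :=
      mul_le_mul_of_nonneg_left hsqrt (by linarith)
    linarith
  have hx1 : α k₀ * β k₀ ≤ 1 := mul_le_one₀ (hαle _ hk₀) (hβ _) (hβle _ hk₀)
  have hx0 : 0 < α k₀ * β k₀ := by
    rcases (mul_nonneg (hα k₀) (hβ k₀)).eq_or_lt with h0 | h0
    · rw [← Real.mul_rpow (hα _) (hβ _), ← h0, Real.zero_rpow (by linarith)] at hk₀lt
      simp at hk₀lt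
    · exact h0
  have hxlow : 1 / 2 ≤ α k₀ * β k₀ := by
    rw [← Real.mul_rpow (hα _) (hβ _), Real.sqrt_eq_rpow] at hk₀lt
    have e : (α k₀ * β k₀) ^ (1 - r) = (α k₀ * β k₀) ^ (τ * r / 2) * (α k₀ * β k₀) ^ ((1:ℝ) / 2) := by
      rw [← Real.rpow_add hx0]; congr 1; linarith
    rw [e] at hk₀lt
    have h1 := lt_of_mul_lt_mul_right hk₀lt (by positivity)
    have h2 := aux_bern (α k₀ * β k₀) (τ * r / 2) hx0.le (by positivity) (by linarith)
    by_contra hcon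
    push Not at hcon
    nlinarith
  have hαk := hαle _ hk₀
  have hβk := hβle _ hk₀
  have ha2 : 1 - α k₀ ≤ 1 / 2 := by nlinarith [hα k₀, hβ k₀]
  have hb2 : 1 - β k₀ ≤ 1 / 2 := by nlinarith [hα k₀, hβ k₀]
  set a := 1 - α k₀ with ha
  set b := 1 - β k₀ with hb
  have ha0 : 0 ≤ a := by linarith
  have hb0 : 0 ≤ b := by linarith
  have hsa : ∑ k ∈ (range N).erase k₀, α k = a := by
    have := Finset.add_sum_erase _ α hk₀
    linarith
  have hsb : ∑ k ∈ (range N).erase k₀, β k = b := by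
    have := Finset.add_sum_erase _ β hk₀
    linarith
  have hαa : ∀ k ∈ (range N).erase k₀, α k ≤ a := fun k hk => by
    rw [← hsa]; exact Finset.single_le_sum (fun i _ => hα i) hk
  have hβb : ∀ k ∈ (range N).erase k₀, β k ≤ b := fun k hk => by
    rw [← hsb]; exact Finset.single_le_sum (fun i _ => hβ i) hk
  have hgain : ∀ x c : ℝ, 0 ≤ x → x ≤ c → c ≤ 1 / 2 →
      x ^ (1 - r) * x ^ (1 - r) ≤ (1 - τ * r / 2) * x := by
    intro x c hx hxc hc
    rw [hsq x hx, mul_comm]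
    apply mul_le_mul_of_nonneg_right _ hx
    have := aux_bern x (τ * r) hx hτr.le hτr1
    nlinarith
  obtain ⟨c, hc⟩ : ∃ c, c = (a + b) / 2 := ⟨_, rfl⟩
  have hc0 : 0 ≤ c := by linarith
  have hc1 : c ≤ 1 / 2 := by linarith
  have hdiag : ∑ k ∈ range N, α k ^ (1 - r) * β k ^ (1 - r) ≤ 1 - τ * r / 2 * c := by
    rw [← Finset.add_sum_erase _ _ hk₀]
    have h1 : α k₀ ^ (1 - r) * β k₀ ^ (1 - r) ≤ 1 - c := by
      have h1 := hsq1 _ (hα k₀) hαk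
      have h2 := hsq1 _ (hβ k₀) hβk
      nlinarith [sq_nonneg (α k₀ ^ (1 - r) - β k₀ ^ (1 - r))]
    have h2 : ∑ k ∈ (range N).erase k₀, α k ^ (1 - r) * β k ^ (1 - r) ≤
        ∑ k ∈ (range N).erase k₀, ((1 - τ * r / 2) / 2 * α k + (1 - τ * r / 2) / 2 * β k) := by
      refine Finset.sum_le_sum fun k hk => ?_
      have h1 := hgain _ _ (hα k) (hαa k hk) ha2
      have h2 := hgain _ _ (hβ k) (hβb k hk) hb2
      nlinarith [sq_nonneg (α k ^ (1 - r) - β k ^ (1 - r))]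
    rw [Finset.sum_add_distrib, ← Finset.mul_sum, ← Finset.mul_sum, hsa, hsb] at h2
    have : (1 - τ * r / 2) / 2 * a + (1 - τ * r / 2) / 2 * b = (1 - τ * r / 2) * c := by
      rw [hc]; ring
    linarith
  have hs0 : 0 ≤ 1 - r := by linarith
  have hpow : ∀ x, 0 ≤ x → x ≤ 2 * c → x ^ (1 - r) ≤ 2 * c ^ (1 - r) := by
    intro x hx hxc
    calc x ^ (1 - r) ≤ (2 * c) ^ (1 - r) := Real.rpow_le_rpow hx hxc hs0
      _ = 2 ^ (1 - r) * c ^ (1 - r) := Real.mul_rpow (by norm_num) hc0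
      _ ≤ 2 ^ (1 : ℝ) * c ^ (1 - r) := by
          apply mul_le_mul_of_nonneg_right _ (by positivity)
          exact Real.rpow_le_rpow_of_exponent_le (by norm_num) (by linarith)
      _ = _ := by simp
  have hoff : ∑ k ∈ range N, ∑ l ∈ range N, K k l * (α k ^ (1 - r) * β l ^ (1 - r))
      ≤ 3 * η * (5 * c ^ (1 - r)) := by
    have h1 := aux_schur N (fun k => α k ^ (1 - r)) (fun k => β k ^ (1 - r))
      (fun k => if k = k₀ then b ^ (1 - r) else α k / 2)
      (fun k => if k = k₀ then a ^ (1 - r) else β k / 2) K (3 * η) hK hKd hrow hcol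
      (fun k _ => by have := hα k; split_ifs <;> positivity)
      (fun k _ => by have := hβ k; split_ifs <;> positivity) (by
        intro k hk l hl hkl
        have hx0 := Real.rpow_nonneg (hα k) (1 - r)
        have hy0 := Real.rpow_nonneg (hβ l) (1 - r)
        have hx1 := Real.rpow_le_one (hα k) (hαle k hk) hs0
        have hy1 := Real.rpow_le_one (hβ l) (hβle l hl) hs0
        split_ifs with h1 h2 h2
        · omega
        · have := Real.rpow_le_rpow (hβ l) (hβb l (by simp [h2]; simpa using hl)) hs0
          have := hβ l
          nlinarith
        · have := Real.rpow_le_rpow (hα k) (hαa k (by simp [h1]; simpa using hk)) hs0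
          have := hα k
          nlinarith
        · have h1 := hsq1 _ (hα k) (hαle k hk)
          have h2 := hsq1 _ (hβ l) (hβle l hl)
          nlinarith [sq_nonneg (α k ^ (1 - r) - β l ^ (1 - r))])
    refine h1.trans (mul_le_mul_of_nonneg_left ?_ (by positivity))
    rw [← Finset.add_sum_erase _ _ hk₀, ← Finset.add_sum_erase (range N) (fun k => if k = k₀ then a ^ (1 - r) else β k / 2) hk₀]
    have e1 : ∑ k ∈ (range N).erase k₀, (if k = k₀ then b ^ (1 - r) else α k / 2) = a / 2 := by
      rw [← hsa, Finset.sum_div]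
      refine Finset.sum_congr rfl fun k hk => ?_
      rw [if_neg (Finset.ne_of_mem_erase hk)]
    have e2 : ∑ k ∈ (range N).erase k₀, (if k = k₀ then a ^ (1 - r) else β k / 2) = b / 2 := by
      rw [← hsb, Finset.sum_div]
      refine Finset.sum_congr rfl fun k hk => ?_
      rw [if_neg (Finset.ne_of_mem_erase hk)]
    rw [e1, e2]
    simp only [if_true]
    have h3 := hpow a ha0 (by linarith)
    have h4 := hpow b hb0 (by linarith)
    have h5 : c ≤ c ^ (1 - r) := by
      nth_rw 1 [← Real.rpow_one c]
      exact Real.rpow_le_rpow_of_exponent_ge' hc0 (by linarith) hs0 (by linarith)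
    linarith
  have hmain : τ * r / 2 * c ≤ 3 * η * (5 * c ^ (1 - r)) := by linarith
  have hcr : c ^ r ≤ 90 / τ * η := by
    rcases hc0.eq_or_lt with h0 | h0
    · rw [← h0, Real.zero_rpow (by linarith)]; positivity
    · have e : c = c ^ r * c ^ (1 - r) := by
        rw [← Real.rpow_add h0]; simp
      have hp : 0 < c ^ (1 - r) := by positivity
      have h1 : (τ * r / 2 * c ^ r) * c ^ (1 - r) ≤ (15 * η) * c ^ (1 - r) := by
        rw [mul_assoc, ← e]; linarith
      have h2 := le_of_mul_le_mul_right h1 hp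
      have h3 : 0 < c ^ r := by positivity
      rw [div_mul_eq_mul_div, le_div_iff₀ hτ0]
      have h4 := mul_le_mul_of_nonneg_left hr0.le (mul_pos hτ0 h3).le
      linarith
  have hfin : ∀ x, 0 ≤ x → x ≤ 2 * c → x ^ r ≤ 10 ^ 4 / τ * η := by
    intro x hx hxc
    calc x ^ r ≤ (2 * c) ^ r := Real.rpow_le_rpow hx hxc (by linarith)
      _ = 2 ^ r * c ^ r := Real.mul_rpow (by norm_num) hc0
      _ ≤ 2 ^ (1 : ℝ) * (90 / τ * η) := by
          gcongr
          · norm_num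
          · linarith
      _ = 180 / τ * η := by rw [Real.rpow_one]; ring
      _ ≤ _ := by gcongr; norm_num
  exact ⟨k₀, hαk, hβk, hfin _ ha0 (by linarith), hfin _ hb0 (by linarith)⟩

lemma aux_geo_s18 (u : ℝ) (hu : 0 ≤ u) (hu1 : u ≤ 1 / 3) (N k : ℕ) (hk : k ∈ range N) :
    ∑ l ∈ range N, (if k = l then 0 else u ^ ((k : ℤ) - (l : ℤ)).natAbs) ≤ 3 * u := by
  have h1 : ∀ k : ℕ, ∑ l ∈ range k, u ^ (k - l) ≤ 3 / 2 * u := by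
    intro k
    induction k with
    | zero => simp; positivity
    | succ k ih =>
      rw [Finset.sum_range_succ]
      have : ∑ l ∈ range k, u ^ (k + 1 - l) = u * ∑ l ∈ range k, u ^ (k - l) := by
        rw [Finset.mul_sum]
        refine Finset.sum_congr rfl fun l hl => ?_
        rw [← pow_succ']; congr 1; have := Finset.mem_range.1 hl; omega
      rw [this]; simp; nlinarith
  have h2 : ∀ n : ℕ, ∑ l ∈ range n, u ^ (l + 1) ≤ 3 / 2 * u := by
    intro n
    rw [← Finset.sum_range_reflect]
    refine le_trans (le_of_eq ?_) (h1 n)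
    refine Finset.sum_congr rfl fun l hl => ?_
    congr 1; have := Finset.mem_range.1 hl; omega
  obtain ⟨n, rfl⟩ := Nat.exists_eq_add_of_le (Nat.succ_le_of_lt (Finset.mem_range.1 hk))
  rw [Finset.sum_range_add, Nat.succ_eq_add_one, Finset.sum_range_succ]
  have e1 : ∑ l ∈ range k, (if k = l then 0 else u ^ ((k : ℤ) - (l : ℤ)).natAbs)
      = ∑ l ∈ range k, u ^ (k - l) := by
    refine Finset.sum_congr rfl fun l hl => ?_
    have := Finset.mem_range.1 hl
    rw [if_neg (by omega)]; congr 1; omega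
  have e2 : ∑ l ∈ range n, (if k = k + 1 + l then 0 else u ^ ((k : ℤ) - ((k + 1 + l : ℕ) : ℤ)).natAbs)
      = ∑ l ∈ range n, u ^ (l + 1) := by
    refine Finset.sum_congr rfl fun l hl => ?_
    rw [if_neg (by omega)]; congr 1; omega
  rw [e1, e2]
  have := h1 k
  have := h2 n
  simp; linarith

lemma aux_real (τ r x y X Y ε E Q F D A : ℝ) (hr0 : 0 < r) (hr1 : r < 1) (hr : r * (2 + τ) = 1)
    (hx : 0 ≤ x) (hy : 0 ≤ y) (hX : 0 < X) (hY : 0 < Y) (hE : 0 < E) (hε : 0 ≤ ε)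
    (hεxy : ε ≤ x * y) (hQ : 0 < Q) (hD : 0 < D) (hDF : D ≤ F) (hA : 0 < A)
    (h : (ε / (x * y)) ^ (2 + τ) * x * y * (F * Q) < A * ((E / (X * Y)) ^ (2 + τ) * X * Y * Q)) :
    ε / E ≤ (A / D) ^ r * ((x / X) ^ (1 - r) * (y / Y) ^ (1 - r)) := by
  rcases (mul_nonneg hx hy).eq_or_lt with h0 | h0
  · have : ε = 0 := by linarith
    rw [this, zero_div]; positivity
  have hx' : 0 < x := by
    rcases hx.eq_or_lt with h1 | h1
    · rw [← h1] at h0; simp at h0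
    · exact h1
  have hy' : 0 < y := by
    rcases hy.eq_or_lt with h1 | h1
    · rw [← h1] at h0; simp at h0
    · exact h1
  obtain ⟨θ, hθ⟩ : ∃ θ, θ = ε / E := ⟨_, rfl⟩
  obtain ⟨c, hc⟩ : ∃ c, c = (x / X) * (y / Y) := ⟨_, rfl⟩
  have hc0 : 0 < c := by rw [hc]; positivity
  have hθ0 : 0 ≤ θ := by rw [hθ]; positivity
  have e1 : ε / (x * y) = θ / c * (E / (X * Y)) := by rw [hθ, hc]; field_simp
  rw [e1, Real.mul_rpow (by positivity) (by positivity)] at h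
  obtain ⟨Z, hZ⟩ : ∃ Z, Z = (E / (X * Y)) ^ (2 + τ) := ⟨_, rfl⟩
  have hZ0 : 0 < Z := by rw [hZ]; positivity
  rw [← hZ] at h
  obtain ⟨T, hT⟩ : ∃ T, T = (θ / c) ^ (2 + τ) := ⟨_, rfl⟩
  have hT0 : 0 ≤ T := by rw [hT]; positivity
  rw [← hT] at h
  have exy : x * y = c * (X * Y) := by rw [hc]; field_simp
  have h1 : (T * c * F) * (Z * X * Y * Q) < A * (Z * X * Y * Q) := by
    calc (T * c * F) * (Z * X * Y * Q) = T * Z * (c * (X * Y)) * (F * Q) := by ring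
      _ = T * Z * x * y * (F * Q) := by rw [← exy]; ring
      _ < _ := h
  have h2 : T * c * F < A := lt_of_mul_lt_mul_right h1 (by positivity)
  have h3 : T * c * D ≤ A :=
    le_trans (mul_le_mul_of_nonneg_left hDF (by positivity)) h2.le
  have h4 : T ≤ A / D / c := by
    rw [le_div_iff₀ hc0, le_div_iff₀ hD]; exact h3
  have h5 := Real.rpow_le_rpow hT0 h4 hr0.le
  rw [hT, ← Real.rpow_mul (by positivity), mul_comm (2 + τ) r, hr, Real.rpow_one,
    Real.div_rpow (by positivity) hc0.le, div_le_iff₀ hc0] at h5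
  rw [← Real.mul_rpow (by positivity) (by positivity), ← hc, ← hθ,
    Real.rpow_sub hc0, Real.rpow_one]
  calc θ ≤ _ := h5
    _ = _ := by ring

lemma aux_exact {p v k : ℕ} (hp : p.Prime) (hv : 0 < v) :
    (p ^ k ∣ v ∧ ¬ p ^ (k + 1) ∣ v) ↔ v.factorization p = k := by
  rw [hp.pow_dvd_iff_le_factorization hv.ne', hp.pow_dvd_iff_le_factorization hv.ne']
  omega

lemma aux_sum_exact (mu : ℕ → ℝ) (S : Finset ℕ) (hS : ∀ v ∈ S, 0 < v) (p : ℕ) (hp : p.Prime)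
    (N : ℕ) (hN : ∀ v ∈ S, v.factorization p < N) :
    ∑ k ∈ range N, muSet mu (exactPart S p k) = muSet mu S := by
  unfold muSet exactPart
  rw [← Finset.sum_fiberwise_of_maps_to (s := S) (t := range N) (g := fun v => v.factorization p)
    (fun v hv => by simpa using hN v hv)]
  refine Finset.sum_congr rfl fun k _ => ?_
  refine Finset.sum_congr (Finset.filter_congr fun v hv => ?_) fun _ _ => rfl
  exact aux_exact hp (hS v hv)

lemma aux_mem (G : GCDGraph) {e : ℕ × ℕ} (he : e ∈ G.E) : e.1 ∈ G.V ∧ e.2 ∈ G.W := by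
  simpa using G.E_sub he

lemma aux_sum_edges (G : GCDGraph) (p : ℕ) (hp : p.Prime) (N : ℕ)
    (hV : ∀ v ∈ G.V, v.factorization p < N) (hW : ∀ v ∈ G.W, v.factorization p < N) :
    ∑ k ∈ range N, ∑ l ∈ range N, muEdges G.mu (edgesAt G p k l) = muEdges G.mu G.E := by
  unfold muEdges edgesAt
  rw [← Finset.sum_product', ← Finset.sum_fiberwise_of_maps_to (s := G.E) (t := range N ×ˢ range N)
    (g := fun e => (e.1.factorization p, e.2.factorization p))
    (fun e he => by
      have := aux_mem G he
      simpa using ⟨hV _ this.1, hW _ this.2⟩)]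
  refine Finset.sum_congr rfl fun k _ => ?_
  refine Finset.sum_congr (Finset.filter_congr fun e he => ?_) fun _ _ => rfl
  have hm := aux_mem G he
  simp only [exactPart, Finset.mem_filter, hm.1, hm.2, true_and, aux_exact hp (G.V_pos _ hm.1),
    aux_exact hp (G.W_pos _ hm.2), Prod.ext_iff]

lemma aux_muSet_nonneg (G : GCDGraph) (S : Finset ℕ) : 0 ≤ muSet G.mu S :=
  Finset.sum_nonneg fun n _ => G.mu_nonneg n

lemma aux_muEdges_nonneg (G : GCDGraph) (S : Finset (ℕ × ℕ)) : 0 ≤ muEdges G.mu S :=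
  Finset.sum_nonneg fun n _ => mul_nonneg (G.mu_nonneg _) (G.mu_nonneg _)

lemma aux_muEdges_le (G : GCDGraph) (p k l : ℕ) : muEdges G.mu (edgesAt G p k l) ≤
    muSet G.mu (exactPart G.V p k) * muSet G.mu (exactPart G.W p l) := by
  unfold muSet muEdges
  rw [Finset.sum_mul_sum, ← Finset.sum_product']
  refine Finset.sum_le_sum_of_subset_of_nonneg ?_ fun n _ _ =>
    mul_nonneg (G.mu_nonneg _) (G.mu_nonneg _)
  intro e he
  simp only [edgesAt, Finset.mem_filter] at he
  exact Finset.mem_product.2 he.2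

lemma aux_max (τ : ℝ) (H : GCDGraph) : ∃ H' : GCDGraph, IsSubgraph H' H ∧ H'.P = H.P ∧
    H'.f = H.f ∧ H'.g = H.g ∧ IsMaximal τ H' ∧ quality τ H ≤ quality τ H' := by
  let T := (H.V.powerset ×ˢ (H.W.powerset ×ˢ H.E.powerset)).filter
    (fun t => t.2.2 ⊆ t.1 ×ˢ t.2.1)
  have hT : (H.V, H.W, H.E) ∈ T := by
    simp [T, H.E_sub]
  obtain ⟨t, ht, hmax⟩ := Finset.exists_max_image T
    (fun t => qualityRaw τ H.mu t.1 t.2.1 t.2.2 H.P H.f H.g) ⟨_, hT⟩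
  have ht' : (t.1 ⊆ H.V ∧ t.2.1 ⊆ H.W ∧ t.2.2 ⊆ H.E) ∧ t.2.2 ⊆ t.1 ×ˢ t.2.1 := by
    simpa [T] using ht
  obtain ⟨⟨h1, h2, h3⟩, h4⟩ := ht'
  refine ⟨{ mu := H.mu, mu_nonneg := H.mu_nonneg, V := t.1, W := t.2.1
            V_pos := fun v hv => H.V_pos v (h1 hv), W_pos := fun v hv => H.W_pos v (h2 hv)
            E := t.2.2, E_sub := h4, P := H.P, P_prime := H.P_prime, f := H.f, g := H.g
            f_dvd := fun p hp v hv => H.f_dvd p hp v (h1 hv)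
            g_dvd := fun p hp v hv => H.g_dvd p hp v (h2 hv)
            gcd_exact := fun p hp e he => H.gcd_exact p hp e (h3 he) },
    ⟨rfl, h1, h2, h3, subset_rfl, fun _ _ => rfl, fun _ _ => rfl⟩, rfl, rfl, rfl, ?_, ?_⟩
  · rintro G' ⟨e1, e2, e3, e4, -, e6, e7⟩ e8
    simp only at e1 e2 e3 e4 e6 e7 e8
    have hG' : quality τ G' = qualityRaw τ H.mu G'.V G'.W G'.E H.P H.f H.g := by
      unfold quality qualityRaw
      rw [e1, e8]
      congr 1
      refine Finset.prod_congr rfl fun q hq => ?_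
      rw [e6 q hq, e7 q hq]
    rw [hG']
    refine hmax (G'.V, G'.W, G'.E) ?_
    simp [T, e2.trans h1, e3.trans h2, e4.trans h3, G'.E_sub]
  · have h := hmax (H.V, H.W, H.E) hT
    simp only at h
    unfold quality
    exact h

lemma aux_at (τ : ℝ) (G : GCDGraph) (p : ℕ) (hp : p ∈ R G) (k l : ℕ) :
    ∃ H : GCDGraph, IsSubgraph H G ∧ H.P = insert p G.P ∧ H.f p = k ∧ H.g p = l ∧
      quality τ H = qualityAt τ G p k l ∧ H.V = exactPart G.V p k ∧ H.W = exactPart G.W p l := by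
  obtain ⟨hpp, hpP, -⟩ := hp
  have hne : ∀ q ∈ G.P, q ≠ p := fun q hq h => hpP (h ▸ hq)
  refine ⟨{ mu := G.mu, mu_nonneg := G.mu_nonneg, V := exactPart G.V p k, W := exactPart G.W p l
            V_pos := fun v hv => G.V_pos v (Finset.filter_subset _ _ hv)
            W_pos := fun v hv => G.W_pos v (Finset.filter_subset _ _ hv)
            E := edgesAt G p k l
            E_sub := fun e he => Finset.mem_product.2 (Finset.mem_filter.1 he).2
            P := insert p G.P
            P_prime := ?_
            f := Function.update G.f p k
            g := Function.update G.g p l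
            f_dvd := ?_
            g_dvd := ?_
            gcd_exact := ?_ }, ⟨rfl, Finset.filter_subset _ _, Finset.filter_subset _ _,
              Finset.filter_subset _ _, Finset.subset_insert _ _, ?_, ?_⟩, rfl, ?_, ?_, rfl, rfl, rfl⟩
  · intro q hq
    rcases Finset.mem_insert.1 hq with rfl | hq
    · exact hpp
    · exact G.P_prime q hq
  · intro q hq v hv
    rcases Finset.mem_insert.1 hq with rfl | hq
    · simpa using (Finset.mem_filter.1 hv).2.1
    · simpa [hne q hq] using G.f_dvd q hq v (Finset.filter_subset _ _ hv)
  · intro q hq v hv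
    rcases Finset.mem_insert.1 hq with rfl | hq
    · simpa using (Finset.mem_filter.1 hv).2.1
    · simpa [hne q hq] using G.g_dvd q hq v (Finset.filter_subset _ _ hv)
  · intro q hq e he
    rcases Finset.mem_insert.1 hq with rfl | hq
    · have h1 := (Finset.mem_filter.1 (Finset.mem_filter.1 he).2.1).2
      have h2 := (Finset.mem_filter.1 (Finset.mem_filter.1 he).2.2).2
      simp only [Function.update_self]
      refine ⟨Nat.dvd_gcd ((pow_dvd_pow _ (min_le_left _ _)).trans h1.1)
        ((pow_dvd_pow _ (min_le_right _ _)).trans h2.1), fun h => ?_⟩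
      rcases le_total k l with hkl | hkl
      · rw [min_eq_left hkl] at h; exact h1.2 (h.trans (Nat.gcd_dvd_left _ _))
      · rw [min_eq_right hkl] at h; exact h2.2 (h.trans (Nat.gcd_dvd_right _ _))
    · simpa [hne q hq] using G.gcd_exact q hq e (Finset.filter_subset _ _ he)
  · intro q hq; simp [hne q hq]
  · intro q hq; simp [hne q hq]
  · simp
  · simp

lemma aux_factor (τ : ℝ) (hτ : 0 < τ) (p : ℕ) (hp : p.Prime) (k l : ℕ) :
    (p : ℝ) ^ (((k : ℤ) - (l : ℤ)).natAbs) ≤ (p : ℝ) ^ (((k : ℤ) - (l : ℤ)).natAbs) *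
      ((1 - (if k = l ∧ 1 ≤ k then ((p : ℝ))⁻¹ else 0))⁻¹) ^ 2 *
      ((1 - (p : ℝ) ^ (-1 - τ / 4))⁻¹) ^ 3 := by
  have hp1 : (1 : ℝ) < p := by exact_mod_cast hp.one_lt
  have key : ∀ t : ℝ, 0 ≤ t → t < 1 → 1 ≤ (1 - t)⁻¹ := fun t h0 h1 =>
    (one_le_inv₀ (by linarith)).2 (by linarith)
  have h1 : 1 ≤ (1 - (if k = l ∧ 1 ≤ k then ((p : ℝ))⁻¹ else 0))⁻¹ := by
    split_ifs
    · exact key _ (by positivity) (inv_lt_one_of_one_lt₀ hp1)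
    · simp
  have h2 : 1 ≤ (1 - (p : ℝ) ^ (-1 - τ / 4))⁻¹ :=
    key _ (by positivity) (Real.rpow_lt_one_of_one_lt_of_neg hp1 (by linarith))
  rw [mul_assoc]
  exact le_mul_of_one_le_right (by positivity) (one_le_mul_of_one_le_of_one_le (one_le_pow₀ h1) (one_le_pow₀ h2))

/-- Quality increment unless a prime power divides almost all (`MainLem`). -/
theorem quality_increment_or_prime_power (τ M : ℝ) (hτ : τ ∈ Set.Ioo (0 : ℝ) (1 / 100))
    (hM : 2 ≤ M) (G : GCDGraph) (hδ : 0 < G.density)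
    (p : ℕ) (hp : p ∈ R G) (hpC2 : C2 τ M < (p : ℝ)) :
    (∃ G' : GCDGraph, IsSubgraph G' G ∧ 0 < G'.density ∧
      IsMaximal τ G' ∧
      G'.P = insert p G.P ∧
      R G' ⊆ R G \ {p} ∧
      M ^ (if G'.f p = G'.g p then (0 : ℕ) else 1) * quality τ G ≤ quality τ G' ∧
      (∀ v ∈ G'.V, p ^ G'.f p ∣ v ∧ ¬ p ^ (G'.f p + 1) ∣ v) ∧
      (∀ w ∈ G'.W, p ^ G'.g p ∣ w ∧ ¬ p ^ (G'.g p + 1) ∣ w)) ∨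
    (∃ k : ℕ, 1 - C2 τ M / (p : ℝ) ≤ muSet G.mu (exactPart G.V p k) / muSet G.mu G.V ∧
      1 - C2 τ M / (p : ℝ) ≤ muSet G.mu (exactPart G.W p k) / muSet G.mu G.W) := by
  have hτ0 : 0 < τ := hτ.1
  have hτ1 : τ < 1 / 100 := hτ.2
  have hpp : p.Prime := hp.1
  have hpP : p ∉ G.P := hp.2.1
  have hp1 : (1 : ℝ) < p := by exact_mod_cast hpp.one_lt
  have hp0 : (0 : ℝ) < p := by linarith
  -- positivity
  have hXY : 0 < muSet G.mu G.V * muSet G.mu G.W := by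
    rcases (mul_nonneg (aux_muSet_nonneg G G.V) (aux_muSet_nonneg G G.W)).eq_or_lt with h | h
    · unfold density densityRaw at hδ
      rw [← h] at hδ; simp at hδ
    · exact h
  have hX : 0 < muSet G.mu G.V := by
    rcases (aux_muSet_nonneg G G.V).eq_or_lt with h | h
    · rw [← h] at hXY; simp at hXY
    · exact h
  have hY : 0 < muSet G.mu G.W := by
    rcases (aux_muSet_nonneg G G.W).eq_or_lt with h | h
    · rw [← h] at hXY; simp at hXY
    · exact h
  have hE : 0 < muEdges G.mu G.E := by
    unfold density densityRaw at hδ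
    exact (div_pos_iff_of_pos_right hXY).1 hδ
  obtain ⟨Q, hQdef⟩ : ∃ Q, Q = ∏ p ∈ G.P, ((p : ℝ) ^ (((G.f p : ℤ) - (G.g p : ℤ)).natAbs) *
      ((1 - (if G.f p = G.g p ∧ 1 ≤ G.f p then ((p : ℝ))⁻¹ else 0))⁻¹) ^ 2 *
      ((1 - (p : ℝ) ^ (-1 - τ / 4))⁻¹) ^ 3) := ⟨_, rfl⟩
  have hQ : 0 < Q := by
    rw [hQdef]
    refine Finset.prod_pos fun q hq => ?_
    have hq := G.P_prime q hq
    have : (0 : ℝ) < q := by exact_mod_cast hq.pos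
    exact lt_of_lt_of_le (by positivity) (aux_factor τ hτ0 q hq (G.f q) (G.g q))
  have hqG : quality τ G = densityRaw G.mu G.V G.W G.E ^ (2 + τ) * muSet G.mu G.V *
      muSet G.mu G.W * Q := by rw [hQdef]; rfl
  have hqpos : 0 < quality τ G := by
    rw [hqG]
    have : 0 < densityRaw G.mu G.V G.W G.E := hδ
    positivity
  by_cases hcase : ∃ k l : ℕ, M ^ (if k = l then (0 : ℕ) else 1) * quality τ G ≤ qualityAt τ G p k l
  · left
    obtain ⟨k, l, hkl⟩ := hcase
    obtain ⟨H, hHG, hHP, hHf, hHg, hHq, hHV, hHW⟩ := aux_at τ G p hp k l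
    obtain ⟨H', hH'H, hP', hf', hg', hmax, hq'⟩ := aux_max τ H
    have hq2 : M ^ (if k = l then (0 : ℕ) else 1) * quality τ G ≤ quality τ H' := by
      rw [← hHq] at hkl; exact hkl.trans hq'
    have hq3 : 0 < quality τ H' := lt_of_lt_of_le (by positivity) hq2
    obtain ⟨a1, a2, a3, a4, a5, a6, a7⟩ := hHG
    obtain ⟨b1, b2, b3, b4, b5, b6, b7⟩ := hH'H
    refine ⟨H', ⟨b1.trans a1, b2.trans a2, b3.trans a3, b4.trans a4, a5.trans b5,
      fun q hq => (b6 q (a5 hq)).trans (a6 q hq), fun q hq => (b7 q (a5 hq)).trans (a7 q hq)⟩,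
      ?_, hmax, hP'.trans hHP, ?_, ?_, ?_, ?_⟩
    · have h0 : 0 ≤ H'.density := div_nonneg (aux_muEdges_nonneg _ _)
        (mul_nonneg (aux_muSet_nonneg _ _) (aux_muSet_nonneg _ _))
      rcases h0.eq_or_lt with h | h
      · exfalso
        have h' : densityRaw H'.mu H'.V H'.W H'.E = 0 := h.symm
        unfold quality qualityRaw at hq3
        rw [h', Real.zero_rpow (by linarith)] at hq3
        simp at hq3
      · exact h
    · rintro q ⟨hq1, hq2, e, he, hqe⟩
      rw [hP', hHP, Finset.mem_insert, not_or] at hq2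
      exact ⟨⟨hq1, hq2.2, e, a4 (b4 he), hqe⟩, hq2.1⟩
    · rw [hf', hg', hHf, hHg]; exact hq2
    · intro v hv
      rw [hf', hHf]
      have := b2 hv
      rw [hHV] at this
      exact (Finset.mem_filter.1 this).2
    · intro v hv
      rw [hg', hHg]
      have := b3 hv
      rw [hHW] at this
      exact (Finset.mem_filter.1 this).2
  right
  push Not at hcase
  obtain ⟨r, hrdef⟩ : ∃ r, r = 1 / (2 + τ) := ⟨_, rfl⟩
  have hr : r * (2 + τ) = 1 := by rw [hrdef]; field_simp
  have hr0 : 1 / 3 < r := by nlinarith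
  have hr1 : r < 1 / 2 := by nlinarith
  have hMpos : 0 < M := by linarith
  -- bound on each piece
  have hpiece : ∀ k l : ℕ, muEdges G.mu (edgesAt G p k l) / muEdges G.mu G.E ≤
      (M ^ (if k = l then (0 : ℕ) else 1) / (p : ℝ) ^ (((k : ℤ) - (l : ℤ)).natAbs)) ^ r *
      ((muSet G.mu (exactPart G.V p k) / muSet G.mu G.V) ^ (1 - r) *
       (muSet G.mu (exactPart G.W p l) / muSet G.mu G.W) ^ (1 - r)) := by
    intro k l
    refine aux_real τ r _ _ _ _ _ _ Q _ _ _ (by linarith) (by linarith) hr (aux_muSet_nonneg _ _)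
      (aux_muSet_nonneg _ _) hX hY hE (aux_muEdges_nonneg _ _) (aux_muEdges_le _ _ _ _) hQ
      (by positivity) (aux_factor τ hτ0 p hpp k l) (by positivity) ?_
    have h1 := hcase k l
    rw [hqG] at h1
    unfold qualityAt qualityRaw at h1
    rw [Finset.prod_insert hpP] at h1
    have e2 : ∏ q ∈ G.P, ((q : ℝ) ^ (((Function.update G.f p k q : ℤ) -
          (Function.update G.g p l q : ℤ)).natAbs) *
        ((1 - (if Function.update G.f p k q = Function.update G.g p l q ∧
          1 ≤ Function.update G.f p k q then ((q : ℝ))⁻¹ else 0))⁻¹) ^ 2 *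
        ((1 - (q : ℝ) ^ (-1 - τ / 4))⁻¹) ^ 3) = Q := by
      rw [hQdef]
      refine Finset.prod_congr rfl fun q hq => ?_
      have : q ≠ p := fun h => hpP (h ▸ hq)
      rw [Function.update_of_ne this, Function.update_of_ne this]
    rw [e2, Function.update_self, Function.update_self] at h1
    exact h1
  obtain ⟨N, hNdef⟩ : ∃ N, N = G.V.sup id + G.W.sup id + 1 := ⟨_, rfl⟩
  have hNV : ∀ v ∈ G.V, v.factorization p < N := by
    intro v hv
    have h1 := Nat.factorization_lt p (G.V_pos v hv).ne'
    have h2 : v ≤ G.V.sup id := Finset.le_sup (f := id) hv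
    omega
  have hNW : ∀ v ∈ G.W, v.factorization p < N := by
    intro v hv
    have h1 := Nat.factorization_lt p (G.W_pos v hv).ne'
    have h2 : v ≤ G.W.sup id := Finset.le_sup (f := id) hv
    omega
  obtain ⟨u, hu⟩ : ∃ u, u = ((p : ℝ) ^ r)⁻¹ := ⟨_, rfl⟩
  obtain ⟨η, hη⟩ : ∃ η, η = M ^ r * u := ⟨_, rfl⟩
  have hu0 : 0 < u := by rw [hu]; positivity
  have hMr : 0 < M ^ r := by positivity
  have hη0 : 0 < η := by rw [hη]; positivity
  have hηeq : η = (M / p) ^ r := by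
    rw [hη, hu, Real.div_rpow hMpos.le hp0.le]; rfl
  have hC1 : 1 ≤ C1 τ := by
    unfold C1
    rw [le_div_iff₀ hτ0]; norm_num; linarith
  have hC1pos : 0 < C1 τ := by linarith
  have hC1r : C1 τ ≤ (10 * C1 τ ^ 3) ^ r := by
    calc C1 τ = C1 τ ^ (1 : ℝ) := (Real.rpow_one _).symm
      _ ≤ C1 τ ^ (3 * r) := Real.rpow_le_rpow_of_exponent_le hC1 (by linarith)
      _ = (C1 τ ^ 3) ^ r := by
          rw [Real.rpow_mul hC1pos.le]; norm_num
      _ ≤ _ := Real.rpow_le_rpow (by positivity) (by nlinarith [pow_pos hC1pos 3]) (by linarith)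
  have hkey : C1 τ * η ≤ (C2 τ M / p) ^ r := by
    have : C2 τ M / p = (10 * C1 τ ^ 3) * (M / p) := by unfold C2; ring
    rw [this, Real.mul_rpow (by positivity) (by positivity), ← hηeq]
    exact mul_le_mul_of_nonneg_right hC1r hη0.le
  have hC2p : 0 ≤ C2 τ M / p := by unfold C2; positivity
  have hηsmall : η ≤ τ / 10 ^ 4 := by
    have h1 : (C2 τ M / p) ^ r ≤ 1 :=
      Real.rpow_le_one hC2p ((div_le_one hp0).2 hpC2.le) (by linarith)
    have h2 : C1 τ * η ≤ 1 := hkey.trans h1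
    unfold C1 at h2
    rw [div_mul_eq_mul_div, div_le_one hτ0] at h2
    rw [le_div_iff₀ (by norm_num)]; linarith
  have hu3 : u ≤ 1 / 3 := by
    have h1 : 1 ≤ M ^ r := Real.one_le_rpow (by linarith) (by linarith)
    have h2 : u ≤ η := by rw [hη]; nlinarith
    have : τ / 10 ^ 4 < 1 / 3 := by norm_num; linarith
    linarith
  have hgeo := aux_geo_s18 u hu0.le hu3 N
  have hrowsum : ∀ k ∈ range N, ∑ l ∈ range N,
      M ^ r * (if k = l then 0 else u ^ ((k : ℤ) - (l : ℤ)).natAbs) ≤ 3 * η := by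
    intro k hk
    rw [← Finset.mul_sum, hη]
    have := mul_le_mul_of_nonneg_left (hgeo k hk) hMr.le
    linarith
  have hKeq : ∀ k l : ℕ, k ≠ l → (M ^ (if k = l then (0 : ℕ) else 1) / (p : ℝ) ^ (((k : ℤ) - (l : ℤ)).natAbs)) ^ r
      = M ^ r * u ^ ((k : ℤ) - (l : ℤ)).natAbs := by
    intro k l hkl
    rw [if_neg hkl, pow_one, Real.div_rpow hMpos.le (by positivity), hu, inv_pow,
      ← Real.rpow_natCast, ← Real.rpow_natCast, ← Real.rpow_mul hp0.le, ← Real.rpow_mul hp0.le,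
      mul_comm r]
    rfl
  obtain ⟨k, ha1, hb1, ha, hb⟩ := aux_core_s18 τ r η hτ0 hτ1 hr N
    (fun k => muSet G.mu (exactPart G.V p k) / muSet G.mu G.V)
    (fun k => muSet G.mu (exactPart G.W p k) / muSet G.mu G.W)
    (fun k => div_nonneg (aux_muSet_nonneg _ _) hX.le)
    (fun k => div_nonneg (aux_muSet_nonneg _ _) hY.le)
    (by rw [← Finset.sum_div, aux_sum_exact _ _ G.V_pos p hpp N hNV, div_self hX.ne'])
    (by rw [← Finset.sum_div, aux_sum_exact _ _ G.W_pos p hpp N hNW, div_self hY.ne'])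
    (fun k l => M ^ r * (if k = l then 0 else u ^ ((k : ℤ) - (l : ℤ)).natAbs))
    hη0 hηsmall
    (fun k l => by split_ifs <;> positivity)
    (fun k => by simp)
    hrowsum
    (fun l hl => by
      refine le_trans (le_of_eq ?_) (hrowsum l hl)
      refine Finset.sum_congr rfl fun k _ => ?_
      simp only [eq_comm (a := k) (b := l), ← Int.natAbs_neg ((k : ℤ) - (l : ℤ)), neg_sub])
    (by
      have h1 := aux_sum_edges G p hpp N hNV hNW
      have h2 : (1 : ℝ) = ∑ k ∈ range N, ∑ l ∈ range N,
          muEdges G.mu (edgesAt G p k l) / muEdges G.mu G.E := by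
        simp only [← Finset.sum_div]
        rw [h1, div_self hE.ne']
      refine h2.le.trans ?_
      rw [← Finset.sum_add_distrib]
      refine Finset.sum_le_sum fun k hk => ?_
      rw [← Finset.add_sum_erase _ _ hk, ← Finset.add_sum_erase (range N) (fun l => M ^ r * (if k = l then 0 else u ^ ((k : ℤ) - (l : ℤ)).natAbs) * _) hk]
      have h3 := hpiece k k
      simp only [if_true, pow_zero, sub_self, Int.natAbs_zero, div_one, Real.one_rpow, one_mul] at h3
      simp only [if_true, mul_zero, zero_mul, zero_add]
      refine add_le_add h3 (Finset.sum_le_sum fun l hl => ?_)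
      have hkl : k ≠ l := (Finset.ne_of_mem_erase hl).symm
      have h4 := hpiece k l
      rw [hKeq k l hkl] at h4
      rw [if_neg hkl]
      exact h4)
  have hfin : ∀ x : ℝ, x ≤ 1 → (1 - x) ^ r ≤ 10 ^ 4 / τ * η → 1 - C2 τ M / p ≤ x := by
    intro x hx h
    have h1 : (1 - x) ^ r ≤ (C2 τ M / p) ^ r := h.trans hkey
    have h2 := (Real.rpow_le_rpow_iff (by linarith) hC2p (by linarith : 0 < r)).1 h1
    linarith
  exact ⟨k, hfin _ ha1 ha, hfin _ hb1 hb⟩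
end
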